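/- For every finite alphabet A with |A| ≥ 2, there exist computable infinite words x, y ∈ A^ω such that x and y are normal and finite-state independent. -/

import Mathlib

open Filter Topology

namespace FSI

variable {A B D Q : Type*}

/-- The prefix of length `n` of the infinite word `x`. -/
def pref (x : ℕ → A) (n : ℕ) : List A := (List.range n).map x

/-- Number of (possibly overlapping) occurrences of `u` in `w`. -/
noncomputable def occ (w u : List A) : ℕ :=
  Nat.card {i : ℕ | i + u.length ≤ w.length ∧ (w.drop i).take u.length = u}

/-- Number of aligned occurrences of `u` in `w`. -/
noncomputable def alocc (w u : List A) : ℕ :=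
  Nat.card {i : ℕ | i + u.length ≤ w.length ∧ i % u.length = 0 ∧ (w.drop i).take u.length = u}

/-- `x` is simply normal to word length `ℓ`. -/
def SimplyNormalTo [Fintype A] (x : ℕ → A) (ℓ : ℕ) : Prop :=
  ∀ u : List A, u.length = ℓ →
    Tendsto (fun n : ℕ => (alocc (pref x (n * ℓ)) u : ℝ) / n) atTop
      (nhds ((Fintype.card A : ℝ)⁻¹ ^ ℓ))

/-- `x` is a normal infinite word. -/
def Normal [Fintype A] (x : ℕ → A) : Prop := ∀ ℓ : ℕ, 1 ≤ ℓ → SimplyNormalTo x ℓ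

/-! ### Two-tape automata -/

/-- A `2`-automaton with input alphabets `A`, `B` and state set `Q`;
`none` plays the role of the empty word `ε` in transition labels. -/
structure TwoAut (A B Q : Type*) where
  init : Set Q
  trans : Set (Q × (Option A × Option B) × Q)

/-- The support of a label. -/
def lsupp (l : Option A × Option B) : Bool × Bool := (l.1.isSome, l.2.isSome)

/-- A `2`-deterministic `2`-automaton. -/
def TwoAut.TwoDet (M : TwoAut A B Q) : Prop :=
  (∃ q₀, M.init = {q₀}) ∧
  ∀ t ∈ M.trans, ∀ t' ∈ M.trans, t.1 = t'.1 →
    lsupp t.2.1 = lsupp t'.2.1 ∧ (t.2.1 = t'.2.1 → t = t')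

/-- A `1`-deterministic `2`-automaton. -/
def TwoAut.OneDet (M : TwoAut A B Q) : Prop :=
  (∃ q₀, M.init = {q₀}) ∧
  ∀ t ∈ M.trans, ∀ t' ∈ M.trans, t.1 = t'.1 →
    t.2.1.1.isSome = t'.2.1.1.isSome ∧ (t.2.1.1 = t'.2.1.1 → t = t')

/-- `2`-completeness. -/
def TwoAut.TwoComplete (M : TwoAut A B Q) : Prop :=
  ∀ (q : Q) (l l' : Option A × Option B),
    (∃ q', (q, l, q') ∈ M.trans) → lsupp l' = lsupp l → ∃ q', (q, l', q') ∈ M.trans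

/-- Every transition reads exactly one symbol. -/
def TwoAut.OneSymbol (M : TwoAut A B Q) : Prop :=
  ∀ t ∈ M.trans, lsupp t.2.1 = (true, false) ∨ lsupp t.2.1 = (false, true)

def TwoAut.Step (M : TwoAut A B Q) (p q : Q) : Prop := ∃ l, (p, l, q) ∈ M.trans

/-- There is a finite run from `p` to `q`. -/
def TwoAut.Reaches (M : TwoAut A B Q) : Q → Q → Prop := Relation.ReflTransGen M.Step

def TwoAut.StronglyConnected (M : TwoAut A B Q) : Prop := ∀ p q, M.Reaches p q

/-- Word read on the first tape by the first `n` transitions of `γ`. -/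
def in1 (γ : ℕ → Q × (Option A × Option B) × Q) (n : ℕ) : List A :=
  ((List.range n).map fun i => (γ i).2.1.1).reduceOption

/-- Word read on the second tape by the first `n` transitions of `γ`. -/
def in2 (γ : ℕ → Q × (Option A × Option B) × Q) (n : ℕ) : List B :=
  ((List.range n).map fun i => (γ i).2.1.2).reduceOption

/-- `γ` is an infinite run of `M` (not necessarily from the initial state) whose
two input labels are the infinite words `x` and `y`. -/
def TwoAut.IsRunOn (M : TwoAut A B Q) (γ : ℕ → Q × (Option A × Option B) × Q)
    (x : ℕ → A) (y : ℕ → B) : Prop :=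
  (∀ n, γ n ∈ M.trans) ∧ (∀ n, (γ n).2.2 = (γ (n + 1)).1) ∧
  (∀ n, in1 γ n = pref x (in1 γ n).length) ∧ (∀ n, in2 γ n = pref y (in2 γ n).length) ∧
  Tendsto (fun n => (in1 γ n).length) atTop atTop ∧
  Tendsto (fun n => (in2 γ n).length) atTop atTop

/-- The pair `(x, y)` is accepted by `M`. -/
def TwoAut.Accepts (M : TwoAut A B Q) (x : ℕ → A) (y : ℕ → B) : Prop :=
  ∃ γ, (γ 0).1 ∈ M.init ∧ M.IsRunOn γ x y

/-- Number of occurrences of the state `q` among the first `n` transitions of `γ`. -/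
noncomputable def stateCount (γ : ℕ → Q × (Option A × Option B) × Q) (q : Q) (n : ℕ) : ℕ :=
  Nat.card {i : ℕ | i < n ∧ (γ i).1 = q}

/-- Number of occurrences of the transition `τ` among the first `n` transitions of `γ`. -/
noncomputable def transCount (γ : ℕ → Q × (Option A × Option B) × Q)
    (τ : Q × (Option A × Option B) × Q) (n : ℕ) : ℕ :=
  Nat.card {i : ℕ | i < n ∧ γ i = τ}

/-! ### Markov chain associated with a one-symbol automaton -/

/-- The `(p,q)` entry of the Markov matrix associated with the transition set `T`. -/
noncomputable def markovOf {S : Type*} [Fintype A] [Fintype B]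
    (T : Set (S × (Option A × Option B) × S)) (p q : S) : ℝ :=
  (Nat.card {a : A | (p, (some a, none), q) ∈ T} : ℝ) / (Fintype.card A : ℝ) +
  (Nat.card {b : B | (p, (none, some b), q) ∈ T} : ℝ) / (Fintype.card B : ℝ)

/-- `π` is a stationary distribution for the transition set `T` restricted to the
finite state set `st`. -/
def IsStationaryOn {S : Type*} [Fintype A] [Fintype B]
    (T : Set (S × (Option A × Option B) × S)) (st : Finset S) (π : S → ℝ) : Prop :=
  (∀ s ∈ st, 0 ≤ π s) ∧ (∑ s ∈ st, π s = 1) ∧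
  ∀ q ∈ st, (∑ p ∈ st, π p * markovOf T p q) = π q

/-- `π` is a stationary distribution of the Markov chain associated with `M`. -/
def TwoAut.IsStationary [Fintype A] [Fintype B] [Fintype Q]
    (M : TwoAut A B Q) (π : Q → ℝ) : Prop :=
  IsStationaryOn M.trans Finset.univ π

/-- The frequency property for the pair `(x, y)`: in every strongly connected
`2`-deterministic `2`-automaton (reading one symbol per transition), every infinite run
on a suffix of `x` and a suffix of `y` visits each state with frequency given by the
stationary distribution, and the automaton is `2`-complete. -/
def FreqProp [Fintype A] [Fintype B] (x : ℕ → A) (y : ℕ → B) : Prop :=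
  ∀ (Q' : Type) [Fintype Q'] (M : TwoAut A B Q'), M.TwoDet → M.OneSymbol →
    M.StronglyConnected →
    ∀ (i j : ℕ) (γ : ℕ → Q' × (Option A × Option B) × Q'),
      M.IsRunOn γ (fun n => x (n + i)) (fun n => y (n + j)) →
      M.TwoComplete ∧
      ∃ π : Q' → ℝ, M.IsStationary π ∧
        ∀ q, Tendsto (fun n : ℕ => (stateCount γ q n : ℝ) / n) atTop (nhds (π q))

/-! ### Conditional compressors (2-deterministic 3-automata) -/

/-- A `3`-automaton with two input tapes (alphabets `A` and `B`) and one
output tape (alphabet `D`), with a single initial state. -/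
structure Comp3 (A B D Q : Type*) where
  init : Q
  trans : Set (Q × (Option A × Option B) × List D × Q)

/-- `2`-determinism for `3`-automata. -/
def Comp3.TwoDet (C : Comp3 A B D Q) : Prop :=
  ∀ t ∈ C.trans, ∀ t' ∈ C.trans, t.1 = t'.1 →
    lsupp t.2.1 = lsupp t'.2.1 ∧ (t.2.1 = t'.2.1 → t = t')

def c3in1 (γ : ℕ → Q × (Option A × Option B) × List D × Q) (n : ℕ) : List A :=
  ((List.range n).map fun i => (γ i).2.1.1).reduceOption

def c3in2 (γ : ℕ → Q × (Option A × Option B) × List D × Q) (n : ℕ) : List B :=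
  ((List.range n).map fun i => (γ i).2.1.2).reduceOption

def c3out (γ : ℕ → Q × (Option A × Option B) × List D × Q) (n : ℕ) : List D :=
  ((List.range n).map fun i => (γ i).2.2.1).flatten

/-- `γ` is the accepting run of `C` on the pair `(x, y)`. -/
def Comp3.IsAccRunOn (C : Comp3 A B D Q) (γ : ℕ → Q × (Option A × Option B) × List D × Q)
    (x : ℕ → A) (y : ℕ → B) : Prop :=
  (γ 0).1 = C.init ∧ (∀ n, γ n ∈ C.trans) ∧ (∀ n, (γ n).2.2.2 = (γ (n + 1)).1) ∧
  (∀ n, c3in1 γ n = pref x (c3in1 γ n).length) ∧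
  (∀ n, c3in2 γ n = pref y (c3in2 γ n).length) ∧
  Tendsto (fun n => (c3in1 γ n).length) atTop atTop ∧
  Tendsto (fun n => (c3in2 γ n).length) atTop atTop ∧
  Tendsto (fun n => (c3out γ n).length) atTop atTop

/-- For every fixed second input `y`, the input-output map `x ↦ C(x,y)` is one-to-one. -/
def Comp3.OneToOne (C : Comp3 A B D Q) : Prop :=
  ∀ (x x' : ℕ → A) (y : ℕ → B) γ γ', C.IsAccRunOn γ x y → C.IsAccRunOn γ' x' y →
    (∀ n, ∃ m, c3out γ n <+: c3out γ' m) → (∀ n, ∃ m, c3out γ' n <+: c3out γ m) →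
    x = x'

/-- The conditional compression ratio `ρ(x/y)`: the infimum, over all conditional
compressors, of the compression ratio of `x` given the oracle `y`. -/
noncomputable def condRho [Fintype A] [Fintype B] (x : ℕ → A) (y : ℕ → B) : ℝ :=
  sInf {r : ℝ | ∃ (m d : ℕ), 2 ≤ d ∧ ∃ C : Comp3 A B (Fin d) (Fin m),
    C.TwoDet ∧ C.OneToOne ∧ ∃ γ, C.IsAccRunOn γ x y ∧
      r = Filter.liminf (fun n : ℕ =>
        (((c3out γ n).length : ℝ) * Real.log d) /
        (((c3in1 γ n).length : ℝ) * Real.log (Fintype.card A))) atTop}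

/-! ### Compressors (one-to-one 1-deterministic 2-automata) -/

/-- A `2`-automaton with one input tape (alphabet `A`) and one output tape
(alphabet `D`), with a single initial state. -/
structure Comp2 (A D Q : Type*) where
  init : Q
  trans : Set (Q × Option A × List D × Q)

def Comp2.OneDet (C : Comp2 A D Q) : Prop :=
  ∀ t ∈ C.trans, ∀ t' ∈ C.trans, t.1 = t'.1 →
    t.2.1.isSome = t'.2.1.isSome ∧ (t.2.1 = t'.2.1 → t = t')

def c2in (γ : ℕ → Q × Option A × List D × Q) (n : ℕ) : List A :=
  ((List.range n).map fun i => (γ i).2.1).reduceOption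

def c2out (γ : ℕ → Q × Option A × List D × Q) (n : ℕ) : List D :=
  ((List.range n).map fun i => (γ i).2.2.1).flatten

def Comp2.IsAccRunOn (C : Comp2 A D Q) (γ : ℕ → Q × Option A × List D × Q)
    (x : ℕ → A) : Prop :=
  (γ 0).1 = C.init ∧ (∀ n, γ n ∈ C.trans) ∧ (∀ n, (γ n).2.2.2 = (γ (n + 1)).1) ∧
  (∀ n, c2in γ n = pref x (c2in γ n).length) ∧
  Tendsto (fun n => (c2in γ n).length) atTop atTop ∧
  Tendsto (fun n => (c2out γ n).length) atTop atTop

def Comp2.OneToOne (C : Comp2 A D Q) : Prop :=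
  ∀ (x x' : ℕ → A) γ γ', C.IsAccRunOn γ x → C.IsAccRunOn γ' x' →
    (∀ n, ∃ m, c2out γ n <+: c2out γ' m) → (∀ n, ∃ m, c2out γ' n <+: c2out γ m) →
    x = x'

/-- The compression ratio `ρ(x)`. -/
noncomputable def rho [Fintype A] (x : ℕ → A) : ℝ :=
  sInf {r : ℝ | ∃ (m d : ℕ), 2 ≤ d ∧ ∃ C : Comp2 A (Fin d) (Fin m),
    C.OneDet ∧ C.OneToOne ∧ ∃ γ, C.IsAccRunOn γ x ∧
      r = Filter.liminf (fun n : ℕ =>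
        (((c2out γ n).length : ℝ) * Real.log d) /
        (((c2in γ n).length : ℝ) * Real.log (Fintype.card A))) atTop}

/-- Finite-state independence. -/
def FSIndep [Fintype A] [Fintype B] (x : ℕ → A) (y : ℕ → B) : Prop :=
  condRho x y = rho x ∧ condRho y x = rho y ∧ 0 < rho x ∧ 0 < rho y

/-! ### Oblivious selectors with two input tapes -/

/-- Types of states of a selector. -/
inductive SelTy | I | II | III

/-- An oblivious selector with first input alphabet `A` and second input alphabet `B`:
at a state of type I it reads the next symbol of the first input and selects it, at a
state of type II it reads the next symbol of the first input without selecting it, and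
at a state of type III it reads the next symbol of the second input. -/
structure Sel2 (A B : Type*) where
  states : ℕ
  init : Fin states
  ty : Fin states → SelTy
  δa : Fin states → A → Fin states
  δb : Fin states → B → Fin states

/-- Configuration (current state, symbols read from `x`, symbols read from `y`)
after `n` steps. -/
def Sel2.cfg (S : Sel2 A B) (x : ℕ → A) (y : ℕ → B) : ℕ → Fin S.states × ℕ × ℕ
  | 0 => (S.init, 0, 0)
  | n + 1 =>
    let c := S.cfg x y n
    match S.ty c.1 with
    | SelTy.I => (S.δa c.1 (x c.2.1), c.2.1 + 1, c.2.2)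
    | SelTy.II => (S.δa c.1 (x c.2.1), c.2.1 + 1, c.2.2)
    | SelTy.III => (S.δb c.1 (y c.2.2), c.2.1, c.2.2 + 1)

/-- The word selected from `x` during the first `n` steps. -/
def Sel2.outList (S : Sel2 A B) (x : ℕ → A) (y : ℕ → B) (n : ℕ) : List A :=
  (List.range n).filterMap fun i =>
    let c := S.cfg x y i
    match S.ty c.1 with
    | SelTy.I => some (x c.2.1)
    | SelTy.II => none
    | SelTy.III => none

/-! ### Oblivious one-input selection automata -/

/-- An oblivious selection automaton with a single input tape. -/
structure Sel1 (B : Type*) where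
  states : ℕ
  init : Fin states
  sel : Fin states → Bool
  δ : Fin states → B → Fin states

/-- State after reading the first `n` symbols of `y`. -/
def Sel1.st (S : Sel1 B) (y : ℕ → B) : ℕ → Fin S.states
  | 0 => S.init
  | n + 1 => S.δ (S.st y n) (y n)

/-- The word selected from the first `n` symbols of `y`. -/
def Sel1.outList (S : Sel1 B) (y : ℕ → B) (n : ℕ) : List B :=
  (List.range n).filterMap fun i => if S.sel (S.st y i) then some (y i) else none

/-! ### Shufflers -/

/-- A shuffler over the alphabet `A`: at a state of type I it reads, outputs and moves
on the next symbol of the first input; at a state of type II it does so with the second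
input. -/
structure Shuffler (A : Type*) where
  states : ℕ
  init : Fin states
  tyI : Fin states → Bool
  δ : Fin states → A → Fin states

/-- Configuration (current state, symbols read from `x`, symbols read from `y`)
after `n` steps. -/
def Shuffler.cfg (S : Shuffler A) (x y : ℕ → A) : ℕ → Fin S.states × ℕ × ℕ
  | 0 => (S.init, 0, 0)
  | n + 1 =>
    let c := S.cfg x y n
    if S.tyI c.1 then (S.δ c.1 (x c.2.1), c.2.1 + 1, c.2.2)
    else (S.δ c.1 (y c.2.2), c.2.1, c.2.2 + 1)

/-- The output `S(x,y)` of the shuffler `S` on inputs `x` and `y`. -/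
def Shuffler.out (S : Shuffler A) (x y : ℕ → A) (n : ℕ) : A :=
  let c := S.cfg x y n
  if S.tyI c.1 then x c.2.1 else y c.2.2

/-! ### Look-ahead automata -/

/-- The transitions of the look-ahead automaton `𝒜_{k,ℓ}`. -/
def lookTrans (M : TwoAut A B Q) (k ℓ : ℕ) :
    Set ((Q × List A × List B) × (Option A × Option B) × (Q × List A × List B)) :=
  {t | (∃ (q : Q) (u : List A) (a : A), u.length < k ∧
          t = ((q, u, []), (some a, none), (q, u ++ [a], ([] : List B)))) ∨
       (∃ (q : Q) (u : List A) (v : List B) (b : B), u.length = k ∧ v.length < ℓ ∧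
          t = ((q, u, v), (none, some b), (q, u, v ++ [b]))) ∨
       (∃ (q q' : Q) (a a' : A) (u' : List A) (v : List B),
          u'.length = k - 1 ∧ v.length = ℓ ∧ (q, (some a, none), q') ∈ M.trans ∧
          t = ((q, a :: u', v), (some a', none), (q', u' ++ [a'], v))) ∨
       (∃ (q q' : Q) (b b' : B) (u : List A) (v' : List B),
          u.length = k ∧ v'.length = ℓ - 1 ∧ (q, (none, some b), q') ∈ M.trans ∧
          t = ((q, u, b :: v'), (none, some b'), (q', u, v' ++ [b'])))}

/-- The (finite) set of states of the look-ahead automaton with full buffers,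
i.e. `Q × A^k × B^ℓ`. -/
noncomputable def fullFinset (Q A B : Type*) [Fintype Q] [Fintype A] [Fintype B]
    (k ℓ : ℕ) : Finset (Q × List A × List B) :=
  letI := Classical.decEq (Q × List A × List B)
  (Finset.univ : Finset (Q × (Fin k → A) × (Fin ℓ → B))).image
    fun s => (s.1, List.ofFn s.2.1, List.ofFn s.2.2)

/-! ### Counting words and measures -/

/-- The number of words of length `n` with exactly `i` occurrences of `γ`. -/
noncomputable def Ncount (γ : List A) (i n : ℕ) : ℕ :=
  Nat.card {w : List A // w.length = n ∧ occ w γ = i}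

/-- The cylinder of infinite words starting with `w`. -/
def cylinder (w : List A) : Set (ℕ → A) := {x : ℕ → A | pref x w.length = w}

/-- The set `E_S(ε,γ,n)` of pairs of inputs for which the frequency of `γ` in the first
`n` symbols of `S(x,y)` deviates from `|A|^{-|γ|}` by less than `ε`. -/
def Eset [Fintype A] (S : Shuffler A) (ε : ℝ) (γ : List A) (n : ℕ) :
    Set ((ℕ → A) × (ℕ → A)) :=
  {p : (ℕ → A) × (ℕ → A) |
    |(occ (pref (S.out p.1 p.2) n) γ : ℝ) - (n : ℝ) / (Fintype.card A : ℝ) ^ γ.length|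
      < ε * n}

/-- The set `F(ε,t,ℓ,n)`. -/
def Fset [Fintype A] (S : ℕ → Shuffler A) (ε : ℝ) (t ℓ n : ℕ) :
    Set ((ℕ → A) × (ℕ → A)) :=
  ⋂ i ∈ Finset.Icc 1 t, ⋂ r ∈ Finset.Icc 1 ℓ,
    ⋂ γ ∈ {γ : List A | γ.length = r}, Eset (S i) ε γ n

/-- `ℓ_n = (log_{|A|} n)/3`. -/
noncomputable def ellSeq (A : Type*) [Fintype A] (n : ℕ) : ℝ :=
  Real.logb (Fintype.card A) n / 3

/-- `ε_n = 2 √((log n · log_{|A|} n)/n)`. -/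
noncomputable def epsSeq (A : Type*) [Fintype A] (n : ℕ) : ℝ :=
  2 * Real.sqrt (Real.log n * Real.logb (Fintype.card A) n / n)

/-- `F_n = F(ε_n, t_n, ℓ_n, n)` with `t_n = n`. -/
noncomputable def Fn [Fintype A] (S : ℕ → Shuffler A) (n : ℕ) :
    Set ((ℕ → A) × (ℕ → A)) :=
  Fset S (epsSeq A n) n (⌊ellSeq A n⌋).toNat n

/-- `n_start`, the least `n` such that `ε_n ≥ 6/⌊n/ℓ_n⌋`. -/
noncomputable def nStart (A : Type*) [Fintype A] : ℕ :=
  sInf {m : ℕ | 0 < ⌊(m : ℝ) / ellSeq A m⌋ ∧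
    6 / ((⌊(m : ℝ) / ellSeq A m⌋ : ℤ) : ℝ) ≤ epsSeq A m}

/-- `G_n = ⋂_{j=0}^{n} F_{|A|^{n_0+j}}` where `|A|^{n_0} = n_start`. -/
noncomputable def Gn [Fintype A] (S : ℕ → Shuffler A) (n : ℕ) :
    Set ((ℕ → A) × (ℕ → A)) :=
  ⋂ j ∈ Finset.range (n + 1), Fn S (nStart A * Fintype.card A ^ j)

/-- Replace every unbounded search in a code by the zero function. -/
def searchFree (c : Nat.Partrec.Code) : Nat.Partrec.Code :=
  Nat.Partrec.Code.recOn c .zero .succ .left .right (fun _ _ f g => .pair f g)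
    (fun _ _ f g => .comp f g) (fun _ _ f g => .prec f g) (fun _ _ => .zero)

theorem primrec_searchFree : Primrec searchFree :=
  Nat.Partrec.Code.primrec_recOn (α := Nat.Partrec.Code) (σ := Nat.Partrec.Code)
    Primrec.id (Primrec.const _) (Primrec.const _) (Primrec.const _) (Primrec.const _)
    (pr := fun _ _ _ f g => .pair f g) (co := fun _ _ _ f g => .comp f g)
    (pc := fun _ _ _ f g => .prec f g) (rf := fun _ _ _ => .zero)
    (Nat.Partrec.Code.primrec₂_pair.comp
      (Primrec.fst.comp <| Primrec.snd.comp <| Primrec.snd.comp Primrec.snd)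
      (Primrec.snd.comp <| Primrec.snd.comp <| Primrec.snd.comp Primrec.snd))
    (Nat.Partrec.Code.primrec₂_comp.comp
      (Primrec.fst.comp <| Primrec.snd.comp <| Primrec.snd.comp Primrec.snd)
      (Primrec.snd.comp <| Primrec.snd.comp <| Primrec.snd.comp Primrec.snd))
    (Nat.Partrec.Code.primrec₂_prec.comp
      (Primrec.fst.comp <| Primrec.snd.comp <| Primrec.snd.comp Primrec.snd)
      (Primrec.snd.comp <| Primrec.snd.comp <| Primrec.snd.comp Primrec.snd))
    (Primrec.const _)

theorem eval_searchFree_dom (c : Nat.Partrec.Code) : ∀ n, ((searchFree c).eval n).Dom := by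
  induction c with
  | zero => intro n; trivial
  | succ => intro n; trivial
  | left => intro n; trivial
  | right => intro n; trivial
  | pair f g hf hg =>
    intro n
    exact ⟨hf n, hg n⟩
  | comp f g hf hg =>
    intro n
    exact ⟨hg n, hf _⟩
  | prec f g hf hg =>
    intro n
    change ((Nat.Partrec.Code.prec (searchFree f) (searchFree g)).eval n).Dom
    rw [← Nat.pair_unpair n]
    generalize n.unpair.1 = a
    induction n.unpair.2 with
    | zero => rw [Nat.Partrec.Code.eval_prec_zero]; exact hf a
    | succ k ih =>
      rw [Nat.Partrec.Code.eval_prec_succ]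
      exact ⟨ih, hg _⟩
  | rfind' f hf => intro n; trivial

theorem exists_eval_searchFree {f : ℕ → ℕ} (hf : Nat.Primrec f) :
    ∃ c, (searchFree c).eval = fun n => Part.some (f n) := by
  induction hf with
  | zero => exact ⟨.zero, rfl⟩
  | succ => exact ⟨.succ, rfl⟩
  | left => exact ⟨.left, rfl⟩
  | right => exact ⟨.right, rfl⟩
  | pair _ _ hf hg =>
    obtain ⟨c, hc⟩ := hf
    obtain ⟨d, hd⟩ := hg
    refine ⟨.pair c d, ?_⟩
    change (Nat.Partrec.Code.pair (searchFree c) (searchFree d)).eval = _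
    funext n
    simp [Nat.Partrec.Code.eval, hc, hd, Seq.seq]
  | comp _ _ hf hg =>
    obtain ⟨c, hc⟩ := hf
    obtain ⟨d, hd⟩ := hg
    refine ⟨.comp c d, ?_⟩
    change (Nat.Partrec.Code.comp (searchFree c) (searchFree d)).eval = _
    funext n
    simp [Nat.Partrec.Code.eval, hc, hd]
  | prec _ _ hf hg =>
    obtain ⟨c, hc⟩ := hf
    obtain ⟨d, hd⟩ := hg
    refine ⟨.prec c d, ?_⟩
    change (Nat.Partrec.Code.prec (searchFree c) (searchFree d)).eval = _
    funext n
    rw [← Nat.pair_unpair n]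
    generalize n.unpair.1 = a
    induction n.unpair.2 with
    | zero => rw [Nat.Partrec.Code.eval_prec_zero, hc]; simp
    | succ k ih =>
      rw [Nat.Partrec.Code.eval_prec_succ, ih, hd]
      simp

/-- There is a computable function enumerating all primitive recursive functions. -/
theorem exists_universal_primrec :
    ∃ U : ℕ → ℕ → ℕ, Computable₂ U ∧ ∀ f : ℕ → ℕ, Nat.Primrec f → ∃ i, ∀ n, U i n = f n := by
  refine ⟨fun i n => ((searchFree (Denumerable.ofNat _ i)).eval n).get
    (eval_searchFree_dom _ n), ?_, ?_⟩
  · have h : Partrec fun p : ℕ × ℕ =>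
        (searchFree (Denumerable.ofNat Nat.Partrec.Code p.1)).eval p.2 :=
      Nat.Partrec.Code.eval_part.comp
        ((primrec_searchFree.to_comp.comp (Computable.ofNat _)).comp Computable.fst)
        Computable.snd
    exact h.of_eq_tot fun p => Part.get_mem _
  · intro f hf
    obtain ⟨c, hc⟩ := exists_eval_searchFree hf
    refine ⟨Encodable.encode c, fun n => ?_⟩
    simp [hc]

/-! ### A computable path avoiding a computable family of small sets of nodes

The nodes of level `n` of the `c`-ary tree are the numbers below `c ^ n`; the parent of a node `k`
of level `n + 1` is `k / c`. A family of sets of nodes is given by `τ : ℕ → ℕ → ℕ`: the node `k` of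
level `n` is in the family when `τ n k ≠ 0`. -/

/-- Nonzero iff some ancestor-or-self of the node `k` of level `H` is in the family. -/
def badNode (c : ℕ) (τ : ℕ → ℕ → ℕ) (H k : ℕ) : ℕ :=
  ∑ n ∈ Finset.range (H + 1), τ n (k / c ^ (H - n))

/-- The number of bad descendants of level `H` of the node `k` of level `H - d`. -/
def badWeight (c : ℕ) (τ : ℕ → ℕ → ℕ) (H d k : ℕ) : ℕ :=
  ∑ r ∈ Finset.range (c ^ d), min 1 (badNode c τ H (k * c ^ d + r))

theorem sum_range_mul_eq (f : ℕ → ℕ) (m n : ℕ) :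
    ∑ r ∈ Finset.range (m * n), f r =
      ∑ a ∈ Finset.range m, ∑ s ∈ Finset.range n, f (a * n + s) := by
  induction m with
  | zero => simp
  | succ m ih => rw [Nat.succ_mul, Finset.sum_range_add, ih, Finset.sum_range_succ]

theorem badWeight_succ (c : ℕ) (τ : ℕ → ℕ → ℕ) (H d k : ℕ) :
    badWeight c τ H (d + 1) k = ∑ a ∈ Finset.range c, badWeight c τ H d (k * c + a) := by
  unfold badWeight
  rw [pow_succ', sum_range_mul_eq]
  refine Finset.sum_congr rfl fun a _ => Finset.sum_congr rfl fun s _ => ?_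
  congr 2
  ring

theorem badNode_succ {c : ℕ} (τ : ℕ → ℕ → ℕ) (H k : ℕ) :
    badNode c τ (H + 1) k = badNode c τ H (k / c) + τ (H + 1) k := by
  unfold badNode
  rw [Finset.sum_range_succ]
  simp only [Nat.sub_self, pow_zero, Nat.div_one]
  congr 1
  refine Finset.sum_congr rfl fun n hn => ?_
  have : n ≤ H := by simpa [Nat.lt_succ_iff] using hn
  rw [Nat.div_div_eq_div_mul, ← pow_succ', Nat.succ_sub this]

theorem badWeight_step {c : ℕ} (hc : 0 < c) (τ : ℕ → ℕ → ℕ) {H d k : ℕ} (hd : d ≤ H)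
    (hk : k < c ^ (H - d)) :
    badWeight c τ (H + 1) (d + 1) k ≤ c * badWeight c τ H d k +
      {j ∈ Finset.range (c ^ (H + 1)) | τ (H + 1) j ≠ 0}.card := by
  classical
  have h1 : badWeight c τ (H + 1) (d + 1) k ≤
      ∑ r ∈ Finset.range (c ^ (d + 1)), min 1 (badNode c τ H ((k * c ^ (d + 1) + r) / c)) +
      ∑ r ∈ Finset.range (c ^ (d + 1)), min 1 (τ (H + 1) (k * c ^ (d + 1) + r)) := by
    unfold badWeight
    rw [← Finset.sum_add_distrib]
    refine Finset.sum_le_sum fun r _ => ?_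
    rw [badNode_succ]
    omega
  refine h1.trans (add_le_add (le_of_eq ?_) ?_)
  · rw [pow_succ, sum_range_mul_eq]
    unfold badWeight
    rw [Finset.mul_sum]
    refine Finset.sum_congr rfl fun s _ => ?_
    rw [Finset.sum_congr rfl (g := fun _ => min 1 (badNode c τ H (k * c ^ d + s)))]
    · simp
    · intro a ha
      congr 2
      have ha' := Finset.mem_range.1 ha
      rw [show k * (c ^ d * c) + (s * c + a) = a + c * (k * c ^ d + s) by ring,
        Nat.add_mul_div_left _ _ hc, Nat.div_eq_of_lt ha', zero_add]
  · rw [Finset.card_filter, ← Finset.sum_image (f := fun j => min 1 (τ (H + 1) j))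
      (g := fun r => k * c ^ (d + 1) + r)]
    · rw [show ∑ i ∈ Finset.range (c ^ (H + 1)), (if τ (H + 1) i ≠ 0 then 1 else 0) =
        ∑ i ∈ Finset.range (c ^ (H + 1)), min 1 (τ (H + 1) i) from
        Finset.sum_congr rfl fun i _ => by split_ifs <;> omega]
      refine Finset.sum_le_sum_of_subset ?_
      intro j hj
      obtain ⟨r, hr, rfl⟩ := Finset.mem_image.1 hj
      rw [Finset.mem_range] at hr ⊢
      calc k * c ^ (d + 1) + r < k * c ^ (d + 1) + c ^ (d + 1) := by omega
        _ = (k + 1) * c ^ (d + 1) := by ring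
        _ ≤ c ^ (H - d) * c ^ (d + 1) := Nat.mul_le_mul_right _ hk
        _ = c ^ (H + 1) := by rw [← pow_add]; congr 1; omega
    · intro a _ b _ h
      simpa using h

/-- The search for the first child `k * c + a` of `k` whose proportion of bad descendants does not
exceed that of `k`. -/
def goodChild (c : ℕ) (τ : ℕ → ℕ → ℕ) (H d k : ℕ) : ℕ → ℕ
  | 0 => 0
  | j + 1 => if badWeight c τ H d (k * c + goodChild c τ H d k j) * c ≤ badWeight c τ H (d + 1) k
      then goodChild c τ H d k j else goodChild c τ H d k j + 1

theorem goodChild_spec {c : ℕ} (hc : 0 < c) (τ : ℕ → ℕ → ℕ) (H d k : ℕ) :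
    goodChild c τ H d k c < c ∧
    badWeight c τ H d (k * c + goodChild c τ H d k c) * c ≤ badWeight c τ H (d + 1) k := by
  have hex : ∃ a < c, badWeight c τ H d (k * c + a) * c ≤ badWeight c τ H (d + 1) k := by
    by_contra! hcon
    have h := Finset.sum_lt_sum_of_nonempty (s := Finset.range c) ⟨0, by simpa using hc⟩
      (fun a ha => hcon a (Finset.mem_range.1 ha))
    rw [← Finset.sum_mul, ← badWeight_succ] at h
    simp [mul_comm] at h
  obtain ⟨a, hac, ha⟩ := hex
  have key : ∀ j, goodChild c τ H d k j ≤ a ∧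
      (badWeight c τ H d (k * c + goodChild c τ H d k j) * c ≤ badWeight c τ H (d + 1) k ∨
        goodChild c τ H d k j = j) := by
    intro j
    induction j with
    | zero => simp [goodChild]
    | succ j ih =>
      obtain ⟨h1, h2⟩ := ih
      rw [goodChild]
      split_ifs with h
      · exact ⟨h1, Or.inl h⟩
      · refine ⟨?_, Or.inr ?_⟩
        · rcases h1.eq_or_lt with h3 | h3
          · exact absurd (h3 ▸ ha) h
          · exact h3
        · rcases h2 with h2 | h2
          · exact absurd h2 h
          · rw [h2]
  obtain ⟨h1, h2⟩ := key c
  refine ⟨h1.trans_lt hac, h2.resolve_right (by omega)⟩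

/-- The look-ahead level used at level `N`. -/
def horizon (c N : ℕ) : ℕ := (2 * c) ^ (N + 2)

/-- The path obtained by moving to a good child at each level. -/
def goodPath (c : ℕ) (τ : ℕ → ℕ → ℕ) : ℕ → ℕ
  | 0 => 0
  | N + 1 => goodPath c τ N * c +
      goodChild c τ (horizon c N) (horizon c N - (N + 1)) (goodPath c τ N) c

theorem lt_horizon {c : ℕ} (hc : 0 < c) (N : ℕ) : N + 2 < horizon c N :=
  Nat.lt_pow_self (by omega)

theorem goodPath_lt {c : ℕ} (hc : 0 < c) (τ : ℕ → ℕ → ℕ) (N : ℕ) : goodPath c τ N < c ^ N := by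
  induction N with
  | zero => simp [goodPath]
  | succ N ih =>
    have := (goodChild_spec hc τ (horizon c N) (horizon c N - (N + 1)) (goodPath c τ N)).1
    rw [goodPath]
    calc _ < goodPath c τ N * c + c := by omega
      _ = (goodPath c τ N + 1) * c := by ring
      _ ≤ c ^ N * c := Nat.mul_le_mul_right _ ih
      _ = _ := (pow_succ _ _).symm

theorem goodPath_div {c : ℕ} (hc : 0 < c) (τ : ℕ → ℕ → ℕ) (N : ℕ) :
    goodPath c τ (N + 1) / c = goodPath c τ N := by
  have := (goodChild_spec hc τ (horizon c N) (horizon c N - (N + 1)) (goodPath c τ N)).1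
  rw [goodPath, mul_comm, Nat.add_comm, Nat.add_mul_div_left _ _ hc, Nat.div_eq_of_lt this,
    zero_add]

theorem badWeight_telescope {c : ℕ} (hc : 0 < c) {τ : ℕ → ℕ → ℕ}
    (hτ : ∀ n, {j ∈ Finset.range (c ^ n) | τ n j ≠ 0}.card * ((n + 1) * (n + 2)) ≤ c ^ n)
    {H N k : ℕ} (hN : N ≤ H) (hk : k < c ^ N) (m : ℕ) :
    (badWeight c τ (H + m) (H + m - N) k : ℝ) / c ^ (H + m - N) ≤
      (badWeight c τ H (H - N) k : ℝ) / c ^ (H - N) +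
        c ^ N * (1 / (H + 2 : ℝ) - 1 / (H + m + 2 : ℝ)) := by
  have hc0 : (0 : ℝ) < c := by exact_mod_cast hc
  induction m with
  | zero => simp
  | succ m ih =>
    set G := H + m with hG
    have hstep := badWeight_step hc τ (H := G) (d := G - N) (k := k) (by omega)
      (by rwa [show G - (G - N) = N by omega])
    have hsub : H + (m + 1) - N = G - N + 1 := by omega
    rw [hsub, show H + (m + 1) = G + 1 by omega]
    have hcount : (({j ∈ Finset.range (c ^ (G + 1)) | τ (G + 1) j ≠ 0}.card : ℕ) : ℝ) ≤
        c ^ (G + 1) / ((G + 2 : ℝ) * (G + 3)) := by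
      rw [le_div_iff₀ (by positivity)]
      have := hτ (G + 1)
      have h2 : (({j ∈ Finset.range (c ^ (G + 1)) | τ (G + 1) j ≠ 0}.card *
        ((G + 1 + 1) * (G + 1 + 2)) : ℕ) : ℝ) ≤ ((c ^ (G + 1) : ℕ) : ℝ) := by exact_mod_cast this
      push_cast at h2
      calc _ = _ := by ring
        _ ≤ _ := h2
    have hstep' : (badWeight c τ (G + 1) (G - N + 1) k : ℝ) ≤ c * badWeight c τ G (G - N) k +
        c ^ (G + 1) / ((G + 2 : ℝ) * (G + 3)) := by
      have h3 := (Nat.cast_le (α := ℝ)).2 hstep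
      push_cast at h3
      refine h3.trans ?_
      gcongr
    have hpow : (c : ℝ) ^ (G + 1) = c ^ N * c ^ (G - N + 1) := by
      rw [← pow_add]; congr 1; omega
    calc (badWeight c τ (G + 1) (G - N + 1) k : ℝ) / c ^ (G - N + 1)
        ≤ (c * badWeight c τ G (G - N) k +
        c ^ (G + 1) / ((G + 2 : ℝ) * (G + 3))) / c ^ (G - N + 1) := by gcongr
      _ = (badWeight c τ G (G - N) k : ℝ) / c ^ (G - N) + c ^ N / ((G + 2 : ℝ) * (G + 3)) := by
        rw [hpow, pow_succ (c : ℝ) (G - N)]; field_simp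
      _ ≤ _ := by
        have : (c : ℝ) ^ N / ((G + 2 : ℝ) * (G + 3)) =
            c ^ N * (1 / (H + m + 2 : ℝ) - 1 / (H + (m + 1 : ℕ) + 2 : ℝ)) := by
          rw [hG]; push_cast; field_simp; ring
        rw [this]
        linarith [ih]

theorem badWeight_goodPath {c : ℕ} (hc : 0 < c) {τ : ℕ → ℕ → ℕ}
    (hτ : ∀ n, {j ∈ Finset.range (c ^ n) | τ n j ≠ 0}.card * ((n + 1) * (n + 2)) ≤ c ^ n) (N : ℕ) :
    (badWeight c τ (horizon c N) (horizon c N - N) (goodPath c τ N) : ℝ) /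
      c ^ (horizon c N - N) ≤ 1 - (1 / 2) ^ (N + 1) := by
  have hc0 : (0 : ℝ) < c := by exact_mod_cast hc
  induction N with
  | zero =>
    have h := badWeight_telescope hc hτ (H := 0) (N := 0) (k := 0) le_rfl (by simp) (horizon c 0)
    have h0 : badWeight c τ 0 0 0 = 0 := by
      have := hτ 0
      simp only [pow_zero, Finset.range_one, zero_add] at this
      have h1 : τ 0 0 = 0 := by
        by_contra hne
        simp [Finset.filter_singleton, hne] at this
      simp [badWeight, badNode, h1]
    simp only [zero_add, goodPath, Nat.sub_zero, h0] at h ⊢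
    refine h.trans ?_
    have : (0 : ℝ) ≤ 1 / ((horizon c 0 : ℝ) + 2) := by positivity
    norm_num at this ⊢
    exact this
  | succ N ih =>
    set H := horizon c N with hH
    have hNH : N + 2 < H := lt_horizon hc N
    obtain ⟨h1, h2⟩ := goodChild_spec hc τ H (H - (N + 1)) (goodPath c τ N)
    have hle : H ≤ horizon c (N + 1) := Nat.pow_le_pow_right (by omega) (by omega)
    obtain ⟨m, hm⟩ := Nat.exists_eq_add_of_le hle
    rw [hm]
    refine (badWeight_telescope hc hτ (H := H) (by omega) (goodPath_lt hc τ (N + 1)) m).trans ?_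
    have hd : H - (N + 1) + 1 = H - N := by omega
    rw [hd] at h2
    have h3 : (badWeight c τ H (H - (N + 1)) (goodPath c τ (N + 1)) : ℝ) / c ^ (H - (N + 1)) ≤
        1 - (1 / 2) ^ (N + 1) := by
      refine le_trans ?_ ih
      rw [← hd, pow_succ, hd, div_le_div_iff₀ (by positivity) (by positivity)]
      have : (badWeight c τ H (H - (N + 1)) (goodPath c τ (N + 1)) : ℝ) * c ≤
          badWeight c τ H (H - N) (goodPath c τ N) := by exact_mod_cast h2
      nlinarith [pow_pos hc0 (H - (N + 1))]
    have h4 : (c : ℝ) ^ (N + 1) * (1 / (H + 2 : ℝ) - 1 / (H + m + 2 : ℝ)) ≤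
        (1 / 2) ^ (N + 2) := by
      have h5 : (0 : ℝ) ≤ 1 / (H + m + 2 : ℝ) := by positivity
      calc (c : ℝ) ^ (N + 1) * (1 / (H + 2 : ℝ) - 1 / (H + m + 2 : ℝ))
          ≤ (c : ℝ) ^ (N + 1) * (1 / (H + 2 : ℝ)) := by gcongr; linarith
        _ ≤ (1 / 2) ^ (N + 2) := by
          rw [mul_one_div, div_le_iff₀ (by positivity), one_div, inv_pow,
            inv_mul_eq_div, le_div_iff₀ (by positivity)]
          have h6 : (H : ℝ) = c ^ (N + 1) * 2 ^ (N + 2) * c := by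
            rw [hH, horizon]; push_cast; ring
          have h7 : (1 : ℝ) ≤ c := by exact_mod_cast hc
          have h8 : (0 : ℝ) < c ^ (N + 1) * 2 ^ (N + 2) := by positivity
          nlinarith
    have h9 : ((1 : ℝ) / 2) ^ (N + 1) = 2 * (1 / 2) ^ (N + 2) := by ring
    have h10 : ((1 : ℝ) / 2) ^ (N + 1 + 1) = (1 / 2) ^ (N + 2) := rfl
    rw [h10]
    linarith

theorem goodPath_avoids {c : ℕ} (hc : 0 < c) {τ : ℕ → ℕ → ℕ}
    (hτ : ∀ n, {j ∈ Finset.range (c ^ n) | τ n j ≠ 0}.card * ((n + 1) * (n + 2)) ≤ c ^ n) (N : ℕ) :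
    τ N (goodPath c τ N) = 0 := by
  by_contra hne
  have hc0 : (0 : ℝ) < c := by exact_mod_cast hc
  have h := badWeight_goodPath hc hτ N
  have hNH : N + 2 < horizon c N := lt_horizon hc N
  have hfull : badWeight c τ (horizon c N) (horizon c N - N) (goodPath c τ N) =
      c ^ (horizon c N - N) := by
    unfold badWeight
    rw [Finset.sum_congr rfl (g := fun _ => 1)]
    · simp
    · intro r hr
      have : badNode c τ (horizon c N) (goodPath c τ N * c ^ (horizon c N - N) + r) ≠ 0 := by
        unfold badNode
        intro h0
        rw [Finset.sum_eq_zero_iff] at h0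
        have := h0 N (by simp; omega)
        rw [mul_comm, Nat.add_comm, Nat.add_mul_div_left _ _ (by positivity),
          Nat.div_eq_of_lt (Finset.mem_range.1 hr), zero_add] at this
        exact hne this
      omega
  rw [hfull] at h
  push_cast at h
  rw [div_self (by positivity)] at h
  have : (0 : ℝ) < (1 / 2) ^ (N + 1) := by positivity
  linarith

section Computability

variable {α : Type*} [Primcodable α]

theorem computable_sum_range {f : α → ℕ → ℕ} {g : α → ℕ} (hf : Computable₂ f)
    (hg : Computable g) : Computable fun a => ∑ i ∈ Finset.range (g a), f a i := by
  have hstep : Computable₂ fun (a : α) (p : ℕ × ℕ) => p.2 + f a p.1 :=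
    Primrec.nat_add.to_comp.comp (Computable.snd.comp Computable.snd)
      (hf.comp Computable.fst (Computable.fst.comp Computable.snd))
  refine (Computable.nat_rec hg (Computable.const 0) hstep).of_eq fun a => ?_
  induction g a with
  | zero => simp
  | succ n ih => rw [Finset.sum_range_succ, ← ih]

theorem computable_ite_le {f g h k : α → ℕ} (hf : Computable f) (hg : Computable g)
    (hh : Computable h) (hk : Computable k) :
    Computable fun a => if f a ≤ g a then h a else k a := by
  have : Computable fun a => decide (f a ≤ g a) :=
    (Primrec.nat_le.decide.to_comp).comp hf hg
  refine (Computable.cond this hh hk).of_eq fun a => ?_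
  by_cases hle : f a ≤ g a <;> simp [hle]

theorem primrec_pow (c : ℕ) : Primrec fun n : ℕ => c ^ n := by
  have h : Primrec fun n : ℕ => (Nat.rec 1 (fun _ s => s * c) n : ℕ) :=
    Primrec.nat_rec₁ 1 (Primrec.nat_mul.comp Primrec.snd (Primrec.const c))
  refine h.of_eq fun n => ?_
  induction n with
  | zero => rfl
  | succ n ih => rw [pow_succ, ← ih]

theorem computable_pow (c : ℕ) : Computable fun n : ℕ => c ^ n := (primrec_pow c).to_comp

theorem computable_badNode (c : ℕ) {τ : ℕ → ℕ → ℕ} (hτ : Computable₂ τ) :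
    Computable₂ (badNode c τ) := by
  refine computable_sum_range (α := ℕ × ℕ) (f := fun p n => τ n (p.2 / c ^ (p.1 - n)))
    (g := fun p => p.1 + 1) ?_ (Primrec.succ.to_comp.comp Computable.fst)
  refine hτ.comp Computable.snd (Primrec.nat_div.to_comp.comp
    (Computable.snd.comp Computable.fst) ?_)
  exact (computable_pow c).comp (Primrec.nat_sub.to_comp.comp
    (Computable.fst.comp Computable.fst) Computable.snd)

theorem computable_badWeight (c : ℕ) {τ : ℕ → ℕ → ℕ} (hτ : Computable₂ τ) :
    Computable fun p : ℕ × ℕ × ℕ => badWeight c τ p.1 p.2.1 p.2.2 := by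
  refine computable_sum_range (α := ℕ × ℕ × ℕ)
    (f := fun p r => min 1 (badNode c τ p.1 (p.2.2 * c ^ p.2.1 + r)))
    (g := fun p => c ^ p.2.1) ?_ ((computable_pow c).comp (Computable.fst.comp Computable.snd))
  refine Primrec.nat_min.to_comp.comp (Computable.const 1) ?_
  refine (computable_badNode c hτ).comp (Computable.fst.comp Computable.fst) ?_
  refine Primrec.nat_add.to_comp.comp (Primrec.nat_mul.to_comp.comp
    (Computable.snd.comp (Computable.snd.comp Computable.fst)) ?_) Computable.snd
  exact (computable_pow c).comp (Computable.fst.comp (Computable.snd.comp Computable.fst))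

theorem computable_search (c : ℕ) {W : ℕ × ℕ × ℕ → ℕ} (hW : Computable W) :
    Computable fun p : ℕ × ℕ × ℕ => (Nat.rec 0 (fun _ s =>
      if W (p.1, p.2.1, p.2.2 * c + s) * c ≤ W (p.1, p.2.1 + 1, p.2.2) then s else s + 1) c : ℕ) := by
  have hd : Computable fun q : (ℕ × ℕ × ℕ) × ℕ × ℕ => q.1.2.1 :=
    Computable.fst.comp (Computable.snd.comp Computable.fst)
  have hk : Computable fun q : (ℕ × ℕ × ℕ) × ℕ × ℕ => q.1.2.2 :=
    Computable.snd.comp (Computable.snd.comp Computable.fst)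
  have hH : Computable fun q : (ℕ × ℕ × ℕ) × ℕ × ℕ => q.1.1 :=
    Computable.fst.comp Computable.fst
  have hs : Computable fun q : (ℕ × ℕ × ℕ) × ℕ × ℕ => q.2.2 :=
    Computable.snd.comp Computable.snd
  have hstep : Computable₂ fun (p : ℕ × ℕ × ℕ) (q : ℕ × ℕ) =>
      if W (p.1, p.2.1, p.2.2 * c + q.2) * c ≤ W (p.1, p.2.1 + 1, p.2.2)
      then q.2 else q.2 + 1 := by
    refine computable_ite_le (α := (ℕ × ℕ × ℕ) × ℕ × ℕ)
      (Primrec.nat_mul.to_comp.comp ?_ (Computable.const c)) ?_ hs (Primrec.succ.to_comp.comp hs)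
    · exact hW.comp (hH.pair (hd.pair (Primrec.nat_add.to_comp.comp
        (Primrec.nat_mul.to_comp.comp hk (Computable.const c)) hs)))
    · exact hW.comp (hH.pair ((Primrec.succ.to_comp.comp hd).pair hk))
  exact Computable.nat_rec (Computable.const c) (Computable.const 0) hstep

theorem computable_goodChild (c : ℕ) {τ : ℕ → ℕ → ℕ} (hτ : Computable₂ τ) :
    Computable fun p : ℕ × ℕ × ℕ => goodChild c τ p.1 p.2.1 p.2.2 c := by
  refine (computable_search c (computable_badWeight c hτ)).of_eq fun p => ?_
  have : ∀ j : ℕ, (Nat.rec 0 (fun _ s =>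
      if badWeight c τ p.1 p.2.1 (p.2.2 * c + s) * c ≤ badWeight c τ p.1 (p.2.1 + 1) p.2.2
      then s else s + 1) j : ℕ) = goodChild c τ p.1 p.2.1 p.2.2 j := by
    intro j
    induction j with
    | zero => rfl
    | succ j ih => rw [goodChild, ← ih]
  exact this c

theorem computable_goodPath (c : ℕ) {τ : ℕ → ℕ → ℕ} (hτ : Computable₂ τ) :
    Computable (goodPath c τ) := by
  have hh : Computable fun q : ℕ × ℕ × ℕ => horizon c q.2.1 :=
    (computable_pow (2 * c)).comp (Primrec.nat_add.to_comp.comp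
      (Computable.fst.comp Computable.snd) (Computable.const 2))
  have hs : Computable fun q : ℕ × ℕ × ℕ => q.2.2 := Computable.snd.comp Computable.snd
  have hstep : Computable₂ fun (_ : ℕ) (q : ℕ × ℕ) =>
      q.2 * c + goodChild c τ (horizon c q.1) (horizon c q.1 - (q.1 + 1)) q.2 c := by
    refine Primrec.nat_add.to_comp.comp (Primrec.nat_mul.to_comp.comp hs (Computable.const c)) ?_
    exact (computable_goodChild c hτ).comp (hh.pair ((Primrec.nat_sub.to_comp.comp hh
      (Primrec.succ.to_comp.comp (Computable.fst.comp Computable.snd))).pair hs))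
  refine (Computable.nat_rec Computable.id (Computable.const 0) hstep).of_eq fun N => ?_
  induction N with
  | zero => rfl
  | succ N ih => rw [goodPath, ← ih]; rfl

end Computability

/-- The number of words of level `n` on which the function `f` takes the value `1`. -/
def hitCount (c : ℕ) (f : ℕ → ℕ) (n : ℕ) : ℕ :=
  ∑ k ∈ Finset.range (c ^ n), if f (Nat.pair n k) = 1 then 1 else 0

/-- Union of the first `n` tests of the family `U` which are small at level `n`. -/
def diagTest (c : ℕ) (U : ℕ → ℕ → ℕ) (n k : ℕ) : ℕ :=
  ∑ i ∈ Finset.range n, if hitCount c (U i) n * (n + 2) ^ 3 ≤ c ^ n then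
    (if U i (Nat.pair n k) = 1 then 1 else 0) else 0

theorem computable_ite_eq_one {α : Type*} [Primcodable α] {f : α → ℕ} (hf : Computable f) :
    Computable fun a => if f a = 1 then 1 else 0 := by
  have h : Primrec fun n : ℕ => if n = 1 then 1 else 0 :=
    Primrec.ite (Primrec.eq.comp Primrec.id (Primrec.const 1)) (Primrec.const 1) (Primrec.const 0)
  exact h.to_comp.comp hf

theorem computable_diagTest (c : ℕ) {U : ℕ → ℕ → ℕ} (hU : Computable₂ U) :
    Computable₂ (diagTest c U) := by
  have hhit : Computable fun p : ℕ × ℕ => hitCount c (U p.1) p.2 := by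
    refine computable_sum_range (α := ℕ × ℕ)
      (f := fun p k => if U p.1 (Nat.pair p.2 k) = 1 then 1 else 0) (g := fun p => c ^ p.2) ?_
      ((computable_pow c).comp Computable.snd)
    exact computable_ite_eq_one (hU.comp (Computable.fst.comp Computable.fst)
      (Primrec₂.natPair.to_comp.comp (Computable.snd.comp Computable.fst) Computable.snd))
  have hcube : Computable fun n : ℕ => (n + 2) ^ 3 := by
    have h2 : Primrec fun n : ℕ => n + 2 := Primrec.nat_add.comp Primrec.id (Primrec.const 2)
    refine ((Primrec.nat_mul.comp (Primrec.nat_mul.comp h2 h2) h2).of_eq fun n => ?_).to_comp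
    ring
  obtain ⟨g, hg, hgc⟩ : ∃ g : ℕ × ℕ → ℕ, (∀ p, g p = hitCount c (U p.1) p.2) ∧ Computable g :=
    ⟨_, fun _ => rfl, hhit⟩
  have hn : Computable fun q : (ℕ × ℕ) × ℕ => q.1.1 := Computable.fst.comp Computable.fst
  have hsum := computable_sum_range (α := ℕ × ℕ) (f := fun p i =>
    if g (i, p.1) * (p.1 + 2) ^ 3 ≤ c ^ p.1 then
      (if U i (Nat.pair p.1 p.2) = 1 then 1 else 0) else 0) (g := fun p => p.1) ?_ Computable.fst
  · refine hsum.of_eq fun p => ?_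
    simp only [hg, diagTest]
  refine computable_ite_le (α := (ℕ × ℕ) × ℕ) ?_ ((computable_pow c).comp hn) ?_
    (Computable.const 0)
  · exact Primrec.nat_mul.to_comp.comp (hgc.comp (Computable.snd.pair hn)) (hcube.comp hn)
  · exact computable_ite_eq_one (hU.comp Computable.snd
      (Primrec₂.natPair.to_comp.comp hn (Computable.snd.comp Computable.fst)))

theorem diagTest_small (c : ℕ) (U : ℕ → ℕ → ℕ) (n : ℕ) :
    {j ∈ Finset.range (c ^ n) | diagTest c U n j ≠ 0}.card * ((n + 1) * (n + 2)) ≤ c ^ n := by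
  rcases Nat.eq_zero_or_pos n with rfl | hn
  · simp [diagTest]
  have h1 : {j ∈ Finset.range (c ^ n) | diagTest c U n j ≠ 0}.card ≤
      ∑ j ∈ Finset.range (c ^ n), diagTest c U n j := by
    rw [Finset.card_filter]
    refine Finset.sum_le_sum fun j _ => ?_
    split_ifs <;> omega
  have h2 : ∑ j ∈ Finset.range (c ^ n), diagTest c U n j =
      ∑ i ∈ Finset.range n, if hitCount c (U i) n * (n + 2) ^ 3 ≤ c ^ n then
        hitCount c (U i) n else 0 := by
    unfold diagTest
    rw [Finset.sum_comm]
    refine Finset.sum_congr rfl fun i _ => ?_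
    split_ifs
    · rfl
    · simp
  have h3 : (∑ j ∈ Finset.range (c ^ n), diagTest c U n j) * (n + 2) ^ 3 ≤ n * c ^ n := by
    rw [h2, Finset.sum_mul]
    refine (Finset.sum_le_card_nsmul _ _ (c ^ n) fun i _ => ?_).trans (by simp)
    split_ifs with h
    · exact h
    · simp
  have h4 := (Nat.mul_le_mul_right ((n + 2) ^ 3) h1).trans h3
  refine Nat.le_of_mul_le_mul_left (le_trans ?_ h4) hn
  calc n * ({j ∈ Finset.range (c ^ n) | diagTest c U n j ≠ 0}.card * ((n + 1) * (n + 2)))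
      = {j ∈ Finset.range (c ^ n) | diagTest c U n j ≠ 0}.card * (n * (n + 1) * (n + 2)) := by ring
    _ ≤ _ := by gcongr; nlinarith

/-- There is a computable path in the `c`-ary tree passing every small enough primitive recursive
test. -/
theorem exists_computable_path {c : ℕ} (hc : 0 < c) :
    ∃ κ : ℕ → ℕ, Computable κ ∧ (∀ n, κ n < c ^ n) ∧ (∀ n, κ (n + 1) / c = κ n) ∧
      ∀ f : ℕ → ℕ, Nat.Primrec f → (∀ᶠ n in atTop, hitCount c f n * (n + 2) ^ 3 ≤ c ^ n) →
        ∀ᶠ n in atTop, f (Nat.pair n (κ n)) ≠ 1 := by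
  obtain ⟨U, hU, huniv⟩ := exists_universal_primrec
  refine ⟨goodPath c (diagTest c U), computable_goodPath c (computable_diagTest c hU),
    goodPath_lt hc _, goodPath_div hc _, fun f hf hsmall => ?_⟩
  obtain ⟨i, hi⟩ := huniv f hf
  obtain rfl : U i = f := funext hi
  filter_upwards [hsmall, eventually_gt_atTop i] with n hn hin hone
  have h0 := goodPath_avoids hc (diagTest_small c U) n
  unfold diagTest at h0
  rw [Finset.sum_eq_zero_iff] at h0
  have := h0 i (Finset.mem_range.2 hin)
  rw [if_pos hn] at this
  exact one_ne_zero ((if_pos hone).symm.trans this)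

/-- The number of pairs of words of length `n` satisfying the test `P`. -/
def testCount [Fintype A] (P : List A → List A → Bool) (n : ℕ) : ℕ :=
  Finset.card {p : (Fin n → A) × (Fin n → A) | P (List.ofFn p.1) (List.ofFn p.2) = true}

/-- The pair `(x, y)` passes every primitive recursive test of polynomially decaying density. -/
def Passes [Fintype A] [Primcodable A] (x y : ℕ → A) : Prop :=
  ∀ P : List A → List A → Bool, Primrec₂ P →
    (∀ᶠ n in atTop, testCount P n * (n + 2) ^ 3 ≤ (Fintype.card A * Fintype.card A) ^ n) →
    ∀ᶠ n in atTop, P (pref x n) (pref y n) = false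

theorem Passes.symm [Fintype A] [Primcodable A] {x y : ℕ → A} (h : Passes x y) : Passes y x := by
  intro P hP hsmall
  refine h (fun X Y => P Y X) hP.swap ?_
  filter_upwards [hsmall] with n hn
  refine le_trans (Nat.mul_le_mul_right _ (le_of_eq ?_)) hn
  unfold testCount
  refine Finset.card_bij (fun p _ => p.swap) ?_ ?_ ?_
  · simp
  · rintro ⟨a, b⟩ _ ⟨c, d⟩ _ h
    simpa [and_comm] using h
  · rintro ⟨a, b⟩ h
    exact ⟨(b, a), by simpa using h, rfl⟩

theorem eq_of_digits_eq {c : ℕ} (n : ℕ) {k k' : ℕ} (hk : k < c ^ n) (hk' : k' < c ^ n)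
    (h : ∀ p < n, k / c ^ (n - 1 - p) % c = k' / c ^ (n - 1 - p) % c) : k = k' := by
  induction n generalizing k k' with
  | zero => simp at hk hk'; omega
  | succ n ih =>
    have h1 : k / c = k' / c := by
      refine ih (Nat.div_lt_of_lt_mul (by rwa [← pow_succ'])) (Nat.div_lt_of_lt_mul
        (by rwa [← pow_succ'])) fun p hp => ?_
      have := h p (by omega)
      rw [show n + 1 - 1 - p = n - 1 - p + 1 by omega, pow_succ'] at this
      rwa [Nat.div_div_eq_div_mul, Nat.div_div_eq_div_mul]
    have h2 := h n (by omega)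
    simp only [Nat.add_sub_cancel, Nat.sub_self, pow_zero, Nat.div_one] at h2
    rw [← Nat.div_add_mod k c, ← Nat.div_add_mod k' c, h1, h2]

theorem path_div_pow {c : ℕ} {κ : ℕ → ℕ} (h : ∀ n, κ (n + 1) / c = κ n) (n m : ℕ) :
    κ (n + m) / c ^ m = κ n := by
  induction m with
  | zero => simp
  | succ m ih => rw [← add_assoc, pow_succ', ← Nat.div_div_eq_div_mul, h, ih]

theorem exists_computable_passes [Fintype A] [Primcodable A] (hA : 0 < Fintype.card A) :
    ∃ x y : ℕ → A, Computable x ∧ Computable y ∧ Passes x y := by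
  classical
  set b := Fintype.card A with hb
  have e : Fin b ≃ A := (Fintype.equivFin A).symm
  let letter : ℕ → A := fun k => e ⟨k % b, Nat.mod_lt _ hA⟩
  have letter_inj : ∀ k k', letter k = letter k' → k % b = k' % b := by
    intro k k' h
    simpa [letter] using h
  have hletter : Primrec letter :=
    (Primrec.dom_finite e).comp (Primrec.fin_val_iff.1
      (Primrec.nat_mod.comp Primrec.id (Primrec.const b)))
  set c := b * b with hc
  obtain ⟨κ, hκc, hκlt, hκdiv, hκ⟩ := exists_computable_path (c := c) (Nat.mul_pos hA hA)
  have hdivb : Primrec fun k : ℕ => letter (k / b) :=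
    hletter.comp (Primrec.nat_div.comp Primrec.id (Primrec.const b))
  have hword : ∀ g : ℕ → A, Primrec g →
      Primrec₂ fun n k : ℕ => (List.range n).map fun p => g (k / c ^ (n - 1 - p)) := by
    intro g hg
    refine Primrec.list_map (α := ℕ × ℕ) (f := fun q => List.range q.1)
      (g := fun q p => g (q.2 / c ^ (q.1 - 1 - p))) (Primrec.list_range.comp Primrec.fst) ?_
    refine hg.comp (Primrec.nat_div.comp (Primrec.snd.comp Primrec.fst) ((primrec_pow c).comp ?_))
    exact Primrec.nat_sub.comp (Primrec.nat_sub.comp (Primrec.fst.comp Primrec.fst)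
      (Primrec.const 1)) Primrec.snd
  have hpref : ∀ (g : ℕ → A) n, pref (fun p => g (κ (p + 1))) n =
      (List.range n).map fun p => g (κ n / c ^ (n - 1 - p)) := by
    intro g n
    refine List.map_congr_left fun p hp => ?_
    have hp' := List.mem_range.1 hp
    have := path_div_pow hκdiv (p + 1) (n - 1 - p)
    rw [show p + 1 + (n - 1 - p) = n by omega] at this
    simp only [this]
  refine ⟨fun p => letter (κ (p + 1) / b), fun p => letter (κ (p + 1)),
    hdivb.to_comp.comp (hκc.comp Primrec.succ.to_comp),
    hletter.to_comp.comp (hκc.comp Primrec.succ.to_comp), fun P hP hsmall => ?_⟩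
  let W₁ : ℕ → ℕ → List A := fun n k =>
    (List.range n).map fun p => letter (k / c ^ (n - 1 - p) / b)
  let W₂ : ℕ → ℕ → List A := fun n k =>
    (List.range n).map fun p => letter (k / c ^ (n - 1 - p))
  have hW₁ : Primrec₂ W₁ := hword _ hdivb
  have hW₂ : Primrec₂ W₂ := hword _ hletter
  let f : ℕ → ℕ := fun m => cond (P (W₁ m.unpair.1 m.unpair.2) (W₂ m.unpair.1 m.unpair.2)) 1 0
  have hf : Primrec f := by
    have h1 : Primrec fun m : ℕ => m.unpair.1 := Primrec.fst.comp Primrec.unpair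
    have h2 : Primrec fun m : ℕ => m.unpair.2 := Primrec.snd.comp Primrec.unpair
    exact Primrec.cond (hP.comp (hW₁.comp h1 h2) (hW₂.comp h1 h2)) (Primrec.const 1)
      (Primrec.const 0)
  have hfv : ∀ n k, f (Nat.pair n k) = 1 ↔ P (W₁ n k) (W₂ n k) = true := by
    intro n k
    simp only [f, Nat.unpair_pair]
    cases P (W₁ n k) (W₂ n k) <;> simp
  have hev := hκ f (Primrec.nat_iff.1 hf) ?_
  · filter_upwards [hev] with n hn
    rw [Ne, hfv] at hn
    rw [hpref (fun k => letter (k / b)), hpref letter]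
    simpa using hn
  · filter_upwards [hsmall] with n hn
    refine le_trans (Nat.mul_le_mul_right _ ?_) hn
    unfold hitCount testCount
    rw [← Finset.card_filter]
    refine Finset.card_le_card_of_injOn (fun k =>
      (fun p : Fin n => letter (k / c ^ (n - 1 - p) / b),
        fun p : Fin n => letter (k / c ^ (n - 1 - p)))) ?_ ?_
    · intro k hk
      have hk2 := (Finset.mem_filter.1 hk).2
      rw [hfv] at hk2
      have hofn : ∀ g : ℕ → A, List.ofFn (fun p : Fin n => g p) = (List.range n).map g := by
        intro g
        rw [List.ofFn_eq_map, ← List.map_coe_finRange_eq_range, List.map_map]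
        rfl
      simp only [Finset.coe_filter, Finset.mem_univ, true_and, Set.mem_ofPred_eq]
      rw [hofn fun p => letter (k / c ^ (n - 1 - p) / b), hofn fun p => letter (k / c ^ (n - 1 - p))]
      exact hk2
    · intro k hk k' hk' h
      have hkl := Finset.mem_range.1 (Finset.mem_filter.1 hk).1
      have hkl' := Finset.mem_range.1 (Finset.mem_filter.1 hk').1
      refine eq_of_digits_eq n hkl hkl' fun p hp => ?_
      have h1 := letter_inj _ _ (congrFun (Prod.ext_iff.1 h).1 ⟨p, hp⟩)
      have h2 := letter_inj _ _ (congrFun (Prod.ext_iff.1 h).2 ⟨p, hp⟩)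
      simp only at h1 h2
      rw [hc, Nat.mod_mul, Nat.mod_mul, h1, h2]

theorem testCount_eventually_small [Fintype A] (hA : 0 < Fintype.card A)
    {P : List A → List A → Bool} {k : ℕ} {K ρ : ℝ} (hρ0 : 0 < ρ) (hρ1 : ρ < 1)
    (h : ∀ᶠ n : ℕ in atTop, (testCount P n : ℝ) ≤
      K * (n + 2) ^ k * ρ ^ n * ((Fintype.card A * Fintype.card A : ℕ) : ℝ) ^ n) :
    ∀ᶠ n in atTop, testCount P n * (n + 2) ^ 3 ≤ (Fintype.card A * Fintype.card A) ^ n := by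
  have ht := tendsto_pow_const_mul_const_pow_of_abs_lt_one (k + 3) (r := ρ)
    (by rwa [abs_of_pos hρ0])
  have ht2 := (tendsto_add_atTop_iff_nat (f := fun n : ℕ => (n : ℝ) ^ (k + 3) * ρ ^ n) 2).2 ht
  have ht3 := ht2.const_mul (K / ρ ^ 2)
  rw [mul_zero] at ht3
  filter_upwards [h, ht3.eventually (gt_mem_nhds zero_lt_one)] with n hn hlt
  have hc : (0 : ℝ) < ((Fintype.card A * Fintype.card A : ℕ) : ℝ) := by
    exact_mod_cast Nat.mul_pos hA hA
  have h1 : K * (n + 2) ^ k * ρ ^ n * (n + 2) ^ 3 < 1 := by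
    refine lt_of_eq_of_lt ?_ hlt
    push_cast
    field_simp
    ring
  have : ((testCount P n * (n + 2) ^ 3 : ℕ) : ℝ) ≤
      (((Fintype.card A * Fintype.card A) ^ n : ℕ) : ℝ) := by
    push_cast
    push_cast at hn
    calc (testCount P n : ℝ) * (n + 2) ^ 3
        ≤ (K * (n + 2) ^ k * ρ ^ n * (Fintype.card A * Fintype.card A : ℝ) ^ n) * (n + 2) ^ 3 := by
          gcongr
      _ = (K * (n + 2) ^ k * ρ ^ n * (n + 2) ^ 3) * (Fintype.card A * Fintype.card A : ℝ) ^ n := by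
          ring
      _ ≤ 1 * (Fintype.card A * Fintype.card A : ℝ) ^ n := by gcongr
      _ = _ := one_mul _
  exact_mod_cast this

theorem card_block_deviation [Fintype B] [DecidableEq B] (u : B) (K : ℕ) (hK : 0 < K) (N : ℕ) :
    (Finset.card {Z : Fin N → B | N * (K + Fintype.card B) ≤
      Finset.card {k | Z k = u} * (Fintype.card B * K)} : ℝ) ≤
      (Fintype.card B : ℝ) ^ N * Real.exp (-(1 / (4 * K ^ 2))) ^ N := by
  set M := Fintype.card B with hM
  have hM0 : (0 : ℝ) < M := by exact_mod_cast Fintype.card_pos_iff.2 ⟨u⟩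
  have hM1 : (1 : ℝ) ≤ M := by exact_mod_cast Fintype.card_pos_iff.2 ⟨u⟩
  have hK0 : (0 : ℝ) < K := by exact_mod_cast hK
  have hK1 : (1 : ℝ) ≤ K := by exact_mod_cast hK
  set s : ℝ := 1 / (2 * K) with hs
  have hs0 : 0 < s := by positivity
  have hs1 : s ≤ 1 := by rw [hs, div_le_one (by positivity)]; linarith
  have hmom : ∑ Z : Fin N → B, Real.exp s ^ (Finset.card {k | Z k = u}) =
      (Real.exp s + (M - 1)) ^ N := by
    have h1 : ∑ z : B, (if z = u then Real.exp s else 1) = Real.exp s + (M - 1) := by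
      have : ∀ z : B, (if z = u then Real.exp s else 1) = (if z = u then Real.exp s - 1 else 0) + 1 := by
        intro z; split_ifs <;> ring
      simp only [this, Finset.sum_add_distrib, Finset.sum_ite_eq', Finset.mem_univ, if_true,
        Finset.sum_const, Finset.card_univ, nsmul_eq_mul, mul_one, ← hM]
      ring
    rw [← h1, Fintype.sum_pow]
    refine Finset.sum_congr rfl fun Z _ => ?_
    rw [← Finset.prod_filter, Finset.prod_const]
  set S : Finset (Fin N → B) :=
    {Z : Fin N → B | N * (K + M) ≤ Finset.card {k | Z k = u} * (M * K)} with hS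
  have hlow : (S.card : ℝ) * Real.exp (s * (N * (1 / M + 1 / K))) ≤
      (Real.exp s + (M - 1)) ^ N := by
    rw [← hmom, ← nsmul_eq_mul, ← Finset.sum_const]
    refine (Finset.sum_le_sum fun Z hZ => ?_).trans
      (Finset.sum_le_sum_of_subset_of_nonneg (Finset.subset_univ S) fun _ _ _ => by positivity)
    rw [← Real.exp_nat_mul]
    refine Real.exp_le_exp.2 ?_
    rw [mul_comm s]
    refine mul_le_mul_of_nonneg_right ?_ hs0.le
    have hZ' := (Finset.mem_filter.1 hZ).2
    have h2 : (N : ℝ) * (K + M) ≤ (Finset.card {k | Z k = u} : ℝ) * (M * K) := by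
      exact_mod_cast hZ'
    rw [div_add_div _ _ hM0.ne' hK0.ne', mul_div_assoc', div_le_iff₀ (by positivity)]
    linarith
  have hexp : Real.exp s ≤ 1 + s + s ^ 2 := by
    have := abs_le.1 (Real.abs_exp_sub_one_sub_id_le (x := s) (by rwa [abs_of_pos hs0]))
    linarith [this.2]
  have hup : Real.exp s + (M - 1) ≤ M * Real.exp (s / M + s ^ 2) := by
    have h3 := Real.add_one_le_exp (s / M + s ^ 2)
    have h4 : Real.exp s + (M - 1) ≤ M * (s / M + s ^ 2 + 1) := by
      have : M * (s / M + s ^ 2 + 1) = s + M * s ^ 2 + M := by field_simp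
      rw [this]
      nlinarith [sq_nonneg s]
    exact h4.trans (mul_le_mul_of_nonneg_left h3 hM0.le)
  have h5 : (S.card : ℝ) * Real.exp (s * (N * (1 / M + 1 / K))) ≤
      (M * Real.exp (s / M + s ^ 2)) ^ N := by
    refine hlow.trans (pow_le_pow_left₀ ?_ hup N)
    have := Real.exp_pos s
    linarith
  rw [← le_div_iff₀ (Real.exp_pos _)] at h5
  refine h5.trans (le_of_eq ?_)
  rw [mul_pow, mul_div_assoc, ← Real.exp_nat_mul, ← Real.exp_nat_mul, ← Real.exp_sub]
  congr 2
  rw [hs]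
  field_simp
  ring

theorem primrec_sum_range {α : Type*} [Primcodable α] {f : α → ℕ → ℕ} {g : α → ℕ}
    (hf : Primrec₂ f) (hg : Primrec g) :
    Primrec fun a => ∑ i ∈ Finset.range (g a), f a i := by
  have hstep : Primrec₂ fun (a : α) (p : ℕ × ℕ) => p.2 + f a p.1 :=
    Primrec.nat_add.comp (Primrec.snd.comp Primrec.snd)
      (hf.comp Primrec.fst (Primrec.fst.comp Primrec.snd))
  refine (Primrec.nat_rec' hg (Primrec.const 0) hstep).of_eq fun a => ?_
  induction g a with
  | zero => simp
  | succ n ih => rw [Finset.sum_range_succ, ← ih]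

/-- The number of aligned occurrences of `u` among the first `N` blocks of `X`. -/
def blockCount [DecidableEq A] (u X : List A) (N : ℕ) : ℕ :=
  ∑ k ∈ Finset.range N, if (X.drop (k * u.length)).take u.length = u then 1 else 0

/-- The test for words of block length a multiple of `u.length` in which the frequency of `u`
exceeds the expected frequency `1 / M` by at least `1 / K`. -/
def freqTest [DecidableEq A] (u : List A) (M K : ℕ) (X _Y : List A) : Bool :=
  decide (X.length % u.length = 0) && decide (X.length / u.length * (K + M) ≤
    blockCount u X (X.length / u.length) * (M * K))

theorem primrec_freqTest [Primcodable A] [DecidableEq A] (u : List A) (M K : ℕ) :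
    Primrec₂ (freqTest u M K) := by
  have hX : Primrec fun p : List A × List A => p.1.length := Primrec.list_length.comp Primrec.fst
  have hN : Primrec fun p : List A × List A => p.1.length / u.length :=
    Primrec.nat_div.comp hX (Primrec.const _)
  have hcnt : Primrec fun p : List A × List A => blockCount u p.1 (p.1.length / u.length) := by
    refine primrec_sum_range ?_ hN
    refine Primrec.ite (Primrec.eq.comp ?_ (Primrec.const u)) (Primrec.const 1) (Primrec.const 0)
    refine Primrec.list_take.comp (Primrec.const _) (Primrec.list_drop.comp
      (Primrec.nat_mul.comp Primrec.snd (Primrec.const _)) (Primrec.fst.comp Primrec.fst))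
  exact Primrec.and.comp (Primrec.eq.decide.comp (Primrec.nat_mod.comp hX (Primrec.const _))
    (Primrec.const 0)) (Primrec.nat_le.decide.comp (Primrec.nat_mul.comp hN (Primrec.const _))
      (Primrec.nat_mul.comp hcnt (Primrec.const _)))

theorem drop_take_eq_ofFn_iff {ℓ : ℕ} (u : Fin ℓ → A) (L : List A) {i : ℕ} :
    (L.drop i).take ℓ = List.ofFn u ↔ ∀ j : Fin ℓ, L[i + j]? = some (u j) := by
  constructor
  · intro heq j
    have := congrArg (fun l => l[(j : ℕ)]?) heq
    simpa [List.getElem?_take, List.getElem?_drop, List.getElem?_ofFn] using this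
  · intro hj
    refine List.ext_getElem? fun j => ?_
    rw [List.getElem?_take, List.getElem?_ofFn]
    by_cases hlt : j < ℓ
    · simpa [hlt, List.getElem?_drop] using hj ⟨j, hlt⟩
    · simp [hlt]

theorem pref_length (x : ℕ → A) (n : ℕ) : (pref x n).length = n := by simp [pref]

theorem pref_getElem? (x : ℕ → A) {n i : ℕ} (h : i < n) : (pref x n)[i]? = some (x i) := by
  simp [pref, h]

open Classical in
/-- The number of aligned occurrences of `u` among the first `n` blocks of `x`. -/
noncomputable def blockOcc {ℓ : ℕ} (x : ℕ → A) (u : Fin ℓ → A) (n : ℕ) : ℕ :=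
  Finset.card {k ∈ Finset.range n | ∀ j : Fin ℓ, x (k * ℓ + j) = u j}

theorem add_le_mul_of_lt {k n ℓ : ℕ} (h : k < n) : k * ℓ + ℓ ≤ n * ℓ := by
  rw [← Nat.succ_mul]; exact Nat.mul_le_mul_right _ h

theorem pref_block_iff {ℓ : ℕ} (x : ℕ → A) (u : Fin ℓ → A) {k n : ℕ} (h : k < n) :
    ((pref x (n * ℓ)).drop (k * ℓ)).take ℓ = List.ofFn u ↔
      ∀ j : Fin ℓ, x (k * ℓ + j) = u j := by
  have hle := add_le_mul_of_lt (ℓ := ℓ) h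
  rw [drop_take_eq_ofFn_iff u]
  refine forall_congr' fun j => ?_
  rw [pref_getElem? x (by omega)]
  simp

theorem blockCount_pref [DecidableEq A] {ℓ : ℕ} (x : ℕ → A) (u : Fin ℓ → A) (n : ℕ) :
    blockCount (List.ofFn u) (pref x (n * ℓ)) n = blockOcc x u n := by
  classical
  unfold blockCount blockOcc
  rw [Finset.card_filter]
  refine Finset.sum_congr rfl fun k hk => ?_
  have hiff := pref_block_iff x u (Finset.mem_range.1 hk)
  rw [List.length_ofFn]
  by_cases hb : ∀ j : Fin ℓ, x (k * ℓ + j) = u j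
  · rw [if_pos (hiff.2 hb), if_pos hb]
  · rw [if_neg (fun h => hb (hiff.1 h)), if_neg hb]

theorem alocc_pref {ℓ : ℕ} (hℓ : 0 < ℓ) (x : ℕ → A) (u : Fin ℓ → A) (n : ℕ) :
    alocc (pref x (n * ℓ)) (List.ofFn u) = blockOcc x u n := by
  classical
  unfold alocc blockOcc
  rw [List.length_ofFn, pref_length]
  rw [← Finset.card_image_of_injective _ (mul_left_injective₀ (Nat.pos_iff_ne_zero.1 hℓ)),
    ← Nat.card_eq_finsetCard]
  congr 1
  refine congrArg _ (Set.ext fun i => ?_)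
  simp only [Set.mem_ofPred_eq, Finset.coe_image, Finset.coe_filter, Finset.mem_range, Set.mem_image]
  constructor
  · rintro ⟨h1, h2, h3⟩
    obtain ⟨k, rfl⟩ := Nat.dvd_of_mod_eq_zero h2
    rw [mul_comm ℓ k] at h1 h3 ⊢
    have hk : k < n := by
      by_contra hn
      have := Nat.mul_le_mul_right ℓ (not_lt.1 hn)
      omega
    exact ⟨k, ⟨hk, (pref_block_iff x u hk).1 h3⟩, rfl⟩
  · rintro ⟨k, ⟨hk, h⟩, rfl⟩
    exact ⟨add_le_mul_of_lt hk, Nat.mul_mod_left _ _, (pref_block_iff x u hk).2 h⟩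

theorem testCount_freqTest [Fintype A] [DecidableEq A] {ℓ : ℕ} (hℓ : 0 < ℓ) (u : Fin ℓ → A)
    {K : ℕ} (hK : 0 < K) (n : ℕ) :
    (testCount (freqTest (List.ofFn u) (Fintype.card A ^ ℓ) K) n : ℝ) ≤
      Real.exp (-(1 / (4 * K ^ 2)) / ℓ) ^ n * ((Fintype.card A * Fintype.card A : ℕ) : ℝ) ^ n := by
  set b := Fintype.card A with hb
  by_cases hdvd : ℓ ∣ n
  · obtain ⟨N, rfl⟩ := hdvd
    rw [mul_comm ℓ N]
    have hcardB : Fintype.card (Fin ℓ → A) = b ^ ℓ := by simp [hb]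
    have h1 : testCount (freqTest (List.ofFn u) (b ^ ℓ) K) (N * ℓ) ≤
        Finset.card {Z : Fin N → Fin ℓ → A | N * (K + b ^ ℓ) ≤
          Finset.card {k | Z k = u} * (b ^ ℓ * K)} * b ^ (N * ℓ) := by
      have hcardX : Fintype.card (Fin (N * ℓ) → A) = b ^ (N * ℓ) := by simp [hb]
      rw [← hcardX, ← Finset.card_univ, ← Finset.card_product]
      refine Finset.card_le_card_of_injOn
        (fun p => (fun k j => p.1 (finProdFinEquiv (k, j)), p.2)) ?_ ?_
      · rintro ⟨X, Y⟩ h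
        have h := (Finset.mem_filter.1 h).2
        simp only [freqTest, List.length_ofFn, Nat.mul_mod_left, Nat.mul_div_cancel _ hℓ,
          decide_true, Bool.true_and, decide_eq_true_eq] at h
        refine Finset.mem_coe.2 (Finset.mem_product.2 ⟨Finset.mem_filter.2 ⟨Finset.mem_univ _, ?_⟩,
          Finset.mem_univ _⟩)
        refine h.trans (Nat.mul_le_mul_right _ (le_of_eq ?_))
        unfold blockCount
        rw [Finset.card_filter, Finset.sum_range]
        refine Finset.sum_congr rfl fun k _ => ?_
        have hiff : ((List.ofFn X).drop (k * ℓ)).take ℓ = List.ofFn u ↔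
            (fun j => X (finProdFinEquiv (k, j))) = u := by
          rw [drop_take_eq_ofFn_iff, funext_iff]
          refine forall_congr' fun j => ?_
          have hlt : (k : ℕ) * ℓ + j < N * ℓ := by
            have := add_le_mul_of_lt (ℓ := ℓ) k.2
            omega
          rw [List.getElem?_ofFn, dif_pos hlt, Option.some_inj]
          have : (⟨(k : ℕ) * ℓ + j, hlt⟩ : Fin (N * ℓ)) = finProdFinEquiv (k, j) := by
            ext; simp [mul_comm, add_comm]
          rw [this]
        rw [List.length_ofFn, if_congr hiff rfl rfl]
      · rintro ⟨X, Y⟩ _ ⟨X', Y'⟩ _ h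
        obtain ⟨h1, h2⟩ := Prod.ext_iff.1 h
        refine Prod.ext (funext fun i => ?_) h2
        have := congrFun (congrFun h1 (finProdFinEquiv.symm i).1) (finProdFinEquiv.symm i).2
        simpa only [Prod.mk.eta, Equiv.apply_symm_apply] using this
    have h2 := card_block_deviation u K hK N
    rw [hcardB] at h2
    have h3 : (testCount (freqTest (List.ofFn u) (b ^ ℓ) K) (N * ℓ) : ℝ) ≤ _ :=
      (Nat.cast_le (α := ℝ)).2 h1
    push_cast at h3 h2
    refine h3.trans ((mul_le_mul_of_nonneg_right h2 (by positivity)).trans (le_of_eq ?_))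
    rw [← Real.exp_nat_mul, ← Real.exp_nat_mul]
    have hexp : ((N * ℓ : ℕ) : ℝ) * (-(1 / (4 * K ^ 2)) / ℓ) = N * -(1 / (4 * K ^ 2)) := by
      have : (ℓ : ℝ) ≠ 0 := by exact_mod_cast hℓ.ne'
      push_cast
      field_simp
    rw [hexp]
    push_cast
    rw [mul_pow, ← pow_mul, mul_comm ℓ N]
    ring
  · have h0 : testCount (freqTest (List.ofFn u) (b ^ ℓ) K) n = 0 := by
      unfold testCount
      rw [Finset.card_eq_zero, Finset.filter_eq_empty_iff]
      rintro ⟨X, Y⟩ -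
      simp only [freqTest, List.length_ofFn, Nat.dvd_iff_mod_eq_zero.symm, hdvd]
      simp
    rw [h0]
    push_cast
    positivity

theorem Passes.blockOcc_lt [Fintype A] [Primcodable A] (hA : 0 < Fintype.card A) {x y : ℕ → A}
    (h : Passes x y) {ℓ : ℕ} (hℓ : 0 < ℓ) (u : Fin ℓ → A) {K : ℕ} (hK : 0 < K) :
    ∀ᶠ n in atTop, blockOcc x u n * (Fintype.card A ^ ℓ * K) < n * (K + Fintype.card A ^ ℓ) := by
  classical
  have hK0 : (0 : ℝ) < K := by exact_mod_cast hK
  have hℓ0 : (0 : ℝ) < ℓ := by exact_mod_cast hℓ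
  have hev := h (freqTest (List.ofFn u) (Fintype.card A ^ ℓ) K) (primrec_freqTest _ _ _)
    (testCount_eventually_small hA (k := 0) (K := 1)
      (Real.exp_pos (-(1 / (4 * K ^ 2)) / ℓ)) (Real.exp_lt_one_iff.2 (by
        rw [neg_div, neg_lt_zero]; positivity)) (Eventually.of_forall fun n => by
        simpa using testCount_freqTest hℓ u hK n))
  have htend : Tendsto (fun n : ℕ => n * ℓ) atTop atTop :=
    tendsto_atTop_mono (fun n => Nat.le_mul_of_pos_right n hℓ) tendsto_id
  filter_upwards [htend.eventually hev] with n hn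
  simp only [freqTest, pref_length, List.length_ofFn, Nat.mul_mod_left, Nat.mul_div_cancel _ hℓ,
    decide_true, Bool.true_and, decide_eq_false_iff_not, not_le, blockCount_pref] at hn
  exact hn

theorem sum_blockOcc [Fintype A] {ℓ : ℕ} (x : ℕ → A) (n : ℕ) :
    ∑ u : Fin ℓ → A, blockOcc x u n = n := by
  classical
  have h := Finset.card_eq_sum_card_fiberwise (s := Finset.range n) (t := Finset.univ)
    (f := fun k => fun j : Fin ℓ => x (k * ℓ + j)) (fun _ _ => Finset.mem_coe.2 (Finset.mem_univ _))
  rw [Finset.card_range] at h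
  conv_rhs => rw [h]
  refine Finset.sum_congr rfl fun u _ => ?_
  unfold blockOcc
  congr 1
  ext k
  simp [funext_iff]

theorem Passes.tendsto_blockOcc [Fintype A] [Primcodable A] (hA : 0 < Fintype.card A) {x y : ℕ → A}
    (h : Passes x y) {ℓ : ℕ} (hℓ : 0 < ℓ) (u : Fin ℓ → A) :
    Tendsto (fun n : ℕ => (blockOcc x u n : ℝ) / n) atTop (𝓝 ((Fintype.card A : ℝ)⁻¹ ^ ℓ)) := by
  classical
  set M : ℕ := Fintype.card A ^ ℓ with hM
  have hMpos : 0 < M := pow_pos hA _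
  have hM0 : (0 : ℝ) < M := by exact_mod_cast hMpos
  have hup : ∀ (w : Fin ℓ → A) (ε : ℝ), 0 < ε →
      ∀ᶠ n : ℕ in atTop, (blockOcc x w n : ℝ) / n < 1 / M + ε := by
    intro w ε hε
    obtain ⟨k, hk⟩ := exists_nat_one_div_lt hε
    filter_upwards [h.blockOcc_lt hA hℓ w k.succ_pos, eventually_gt_atTop 0] with n hn hn0
    have hn0' : (0 : ℝ) < n := by exact_mod_cast hn0
    have h1 : (blockOcc x w n : ℝ) * (M * ((k : ℝ) + 1)) < n * ((k + 1 : ℝ) + M) := by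
      exact_mod_cast hn
    refine lt_of_lt_of_le (b := 1 / (M : ℝ) + 1 / (k + 1)) ?_ (by linarith)
    rw [div_add_div _ _ hM0.ne' (by positivity), div_lt_div_iff₀ hn0' (by positivity)]
    linarith
  have hlim : ((Fintype.card A : ℝ)⁻¹ ^ ℓ) = 1 / M := by
    rw [hM]; push_cast; rw [inv_pow, one_div]
  rw [hlim]
  rw [tendsto_order]
  constructor
  · intro a ha
    set ε := (1 / (M : ℝ) - a) / M with hε
    have hε0 : 0 < ε := div_pos (by linarith) hM0
    have hall : ∀ᶠ n : ℕ in atTop, ∀ w : Fin ℓ → A, (blockOcc x w n : ℝ) / n < 1 / M + ε :=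
      eventually_all.2 fun w => hup w ε hε0
    filter_upwards [hall, eventually_gt_atTop 0] with n hn hn0
    have hn0' : (0 : ℝ) < n := by exact_mod_cast hn0
    have hsum : ∑ w : Fin ℓ → A, (blockOcc x w n : ℝ) / n = 1 := by
      rw [← Finset.sum_div, div_eq_one_iff_eq hn0'.ne']
      exact_mod_cast sum_blockOcc x n
    rw [← Finset.add_sum_erase _ _ (Finset.mem_univ u)] at hsum
    have hle : ∑ w ∈ Finset.univ.erase u, (blockOcc x w n : ℝ) / n ≤ (M - 1) * (1 / M + ε) := by
      refine (Finset.sum_le_card_nsmul _ _ (1 / M + ε) fun w _ => (hn w).le).trans (le_of_eq ?_)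
      rw [Finset.card_erase_of_mem (Finset.mem_univ _), Finset.card_univ, nsmul_eq_mul]
      have : Fintype.card (Fin ℓ → A) = M := by simp [hM]
      rw [this, Nat.cast_pred hMpos]
    have h1 : (M - 1 : ℝ) * (1 / M + ε) = 1 - 1 / M + (1 / M - a) - ε := by
      rw [hε]; field_simp; ring
    linarith
  · intro a ha
    filter_upwards [hup u (a - 1 / M) (by linarith)] with n hn
    linarith

theorem Passes.normal [Fintype A] [Primcodable A] (hA : 0 < Fintype.card A) {x y : ℕ → A}
    (h : Passes x y) : Normal x := by
  rintro ℓ hℓ v rfl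
  have ht := h.tendsto_blockOcc hA hℓ v.get
  simp only [← alocc_pref (show 0 < v.length from hℓ), List.ofFn_get] at ht
  exact ht

/-- The word formed by the symbols among the first `n` terms of `g`. -/
def optWord (g : ℕ → Option A) (n : ℕ) : List A := ((List.range n).map g).reduceOption

theorem optWord_succ (g : ℕ → Option A) (n : ℕ) :
    optWord g (n + 1) = optWord g n ++ (g n).toList := by
  unfold optWord
  rw [List.range_succ, List.map_append, List.reduceOption_append]
  cases h : g n <;> simp [h, List.reduceOption]

theorem optWord_length_succ (g : ℕ → Option A) (n : ℕ) :
    (optWord g (n + 1)).length = (optWord g n).length + (g n).toList.length := by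
  rw [optWord_succ, List.length_append]

theorem length_toList_le_one (o : Option A) : o.toList.length ≤ 1 := by cases o <;> simp

theorem optWord_length_mono (g : ℕ → Option A) : Monotone fun n => (optWord g n).length :=
  monotone_nat_of_le_succ fun n => by rw [optWord_length_succ]; omega

theorem optWord_length_le (g : ℕ → Option A) (n : ℕ) : (optWord g n).length ≤ n := by
  induction n with
  | zero => simp [optWord]
  | succ n ih =>
    rw [optWord_length_succ]
    have := length_toList_le_one (g n)
    omega

theorem pref_succ (x : ℕ → A) (n : ℕ) : pref x (n + 1) = pref x n ++ [x n] := by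
  simp [pref, List.range_succ]

theorem optWord_eq_pref_iff (g : ℕ → Option A) (x : ℕ → A) :
    (∀ n, optWord g n = pref x (optWord g n).length) ↔
      ∀ n a, g n = some a → x (optWord g n).length = a := by
  constructor
  · intro h n a ha
    have h1 := h (n + 1)
    rw [optWord_length_succ, optWord_succ, ha, Option.toList_some, List.length_singleton,
      pref_succ] at h1
    have h2 := (List.append_inj h1 (by rw [pref_length])).2
    simpa using h2.symm
  · intro h n
    induction n with
    | zero => simp [optWord, pref]
    | succ n ih =>
      rw [optWord_length_succ, optWord_succ]
      cases ha : g n with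
      | none => simpa using ih
      | some a =>
        rw [Option.toList_some, List.length_singleton, pref_succ, ← ih, h n a ha]

theorem optWord_congr {g g' : ℕ → Option A} {n : ℕ} (h : ∀ k < n, g k = g' k) :
    optWord g n = optWord g' n := by
  unfold optWord
  congr 1
  exact List.map_congr_left fun k hk => h k (List.mem_range.1 hk)

theorem optWord_length_eq_card (g : ℕ → Option A) (n : ℕ) :
    (optWord g n).length = Finset.card {k ∈ Finset.range n | (g k).isSome = true} := by
  induction n with
  | zero => simp [optWord]
  | succ n ih =>
    rw [optWord_length_succ, Finset.range_add_one, Finset.filter_insert, ih]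
    cases h : g n <;> simp

/-- If the number of symbols tends to infinity then a symbol occurs after every index. -/
theorem exists_isSome_of_tendsto {g : ℕ → Option A}
    (h : Tendsto (fun n => (optWord g n).length) atTop atTop) (t : ℕ) :
    ∃ s, (g (t + s)).isSome = true := by
  by_contra! hcon
  have hconst : ∀ s, (optWord g (t + s)).length = (optWord g t).length := by
    intro s
    induction s with
    | zero => rfl
    | succ s ih =>
      have hn : g (t + s) = none := by simpa using hcon s
      rw [← add_assoc, optWord_length_succ, ih, hn]
      simp
  obtain ⟨n, hn⟩ := (h.eventually (eventually_gt_atTop (optWord g t).length)).exists_forall_of_atTop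
  have h1 := hn (max n t) (le_max_left _ _)
  obtain ⟨s, hs⟩ := Nat.exists_eq_add_of_le (le_max_right n t)
  rw [hs, hconst] at h1
  exact lt_irrefl _ h1

theorem exists_optWord_length_eq {g : ℕ → Option A}
    (h : Tendsto (fun n => (optWord g n).length) atTop atTop) (p : ℕ) :
    ∃ t, (optWord g t).length = p := by
  induction p with
  | zero => exact ⟨0, by simp [optWord]⟩
  | succ p ih =>
    obtain ⟨t, ht⟩ := ih
    have hex := exists_isSome_of_tendsto h t
    classical
    refine ⟨t + Nat.find hex + 1, ?_⟩
    have hconst : ∀ s ≤ Nat.find hex, (optWord g (t + s)).length = p := by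
      intro s
      induction s with
      | zero => intro _; exact ht
      | succ s ih =>
        intro hs
        have hn : g (t + s) = none := by simpa using Nat.find_min hex hs
        rw [← add_assoc, optWord_length_succ, ih (by omega), hn]
        simp
    rw [optWord_length_succ, hconst _ le_rfl]
    obtain ⟨a, ha⟩ := Option.isSome_iff_exists.1 (Nat.find_spec hex)
    rw [ha]
    simp

/-! ### Deterministic runs -/

theorem Comp3.TwoDet.eq_of_labels {C : Comp3 A B D Q} (hC : C.TwoDet)
    {t t' : Q × (Option A × Option B) × List D × Q} (ht : t ∈ C.trans) (ht' : t' ∈ C.trans)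
    (hsrc : t.1 = t'.1)
    (h1 : ∀ a a', t.2.1.1 = some a → t'.2.1.1 = some a' → a = a')
    (h2 : ∀ b b', t.2.1.2 = some b → t'.2.1.2 = some b' → b = b') : t = t' := by
  obtain ⟨hs, heq⟩ := hC t ht t' ht' hsrc
  refine heq (Prod.ext ?_ ?_)
  · have h3 := congrArg Prod.fst hs
    simp only [lsupp] at h3
    cases h4 : t.2.1.1 <;> cases h5 : t'.2.1.1 <;> simp_all
  · have h3 := congrArg Prod.snd hs
    simp only [lsupp] at h3
    cases h4 : t.2.1.2 <;> cases h5 : t'.2.1.2 <;> simp_all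

section AccRun

variable {C : Comp3 A B D Q} {γ : ℕ → Q × (Option A × Option B) × List D × Q}
  {x : ℕ → A} {y : ℕ → B}

theorem Comp3.IsAccRunOn.symbol1 (h : C.IsAccRunOn γ x y) {n : ℕ} {a : A}
    (ha : (γ n).2.1.1 = some a) : x (c3in1 γ n).length = a :=
  (optWord_eq_pref_iff (fun i => (γ i).2.1.1) x).1 h.2.2.2.1 n a ha

theorem Comp3.IsAccRunOn.symbol2 (h : C.IsAccRunOn γ x y) {n : ℕ} {b : B}
    (hb : (γ n).2.1.2 = some b) : y (c3in2 γ n).length = b :=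
  (optWord_eq_pref_iff (fun i => (γ i).2.1.2) y).1 h.2.2.2.2.1 n b hb

theorem c3in1_length_succ (γ : ℕ → Q × (Option A × Option B) × List D × Q) (n : ℕ) :
    (c3in1 γ (n + 1)).length = (c3in1 γ n).length + (γ n).2.1.1.toList.length :=
  optWord_length_succ (fun i => (γ i).2.1.1) n

theorem c3in2_length_succ (γ : ℕ → Q × (Option A × Option B) × List D × Q) (n : ℕ) :
    (c3in2 γ (n + 1)).length = (c3in2 γ n).length + (γ n).2.1.2.toList.length :=
  optWord_length_succ (fun i => (γ i).2.1.2) n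

theorem c3in1_length_le (γ : ℕ → Q × (Option A × Option B) × List D × Q) (n : ℕ) :
    (c3in1 γ n).length ≤ n := optWord_length_le (fun i => (γ i).2.1.1) n

theorem c3in2_length_le (γ : ℕ → Q × (Option A × Option B) × List D × Q) (n : ℕ) :
    (c3in2 γ n).length ≤ n := optWord_length_le (fun i => (γ i).2.1.2) n

theorem c3in1_length_mono (γ : ℕ → Q × (Option A × Option B) × List D × Q) :
    Monotone fun n => (c3in1 γ n).length := optWord_length_mono fun i => (γ i).2.1.1

theorem c3in2_length_mono (γ : ℕ → Q × (Option A × Option B) × List D × Q) :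
    Monotone fun n => (c3in2 γ n).length := optWord_length_mono fun i => (γ i).2.1.2

theorem c3out_succ (γ : ℕ → Q × (Option A × Option B) × List D × Q) (n : ℕ) :
    c3out γ (n + 1) = c3out γ n ++ (γ n).2.2.1 := by
  simp [c3out, List.range_succ]

/-- A deterministic automaton cannot make arbitrarily many consecutive moves reading no symbol. -/
theorem Comp3.TwoDet.exists_delay [Finite Q] (hC : C.TwoDet) :
    ∃ E : ℕ, ∀ γ x y, C.IsAccRunOn γ x y → ∀ t, ∃ s ≤ E, lsupp (γ (t + s)).2.1 ≠ (false, false) := by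
  have hq : ∀ q : Q, ∃ E : ℕ, ∀ γ x y, C.IsAccRunOn γ x y → ∀ t, (γ t).1 = q →
      ∃ s ≤ E, lsupp (γ (t + s)).2.1 ≠ (false, false) := by
    intro q
    by_cases hv : ∃ γ x y t, C.IsAccRunOn γ x y ∧ (γ t).1 = q
    · obtain ⟨γ₀, x₀, y₀, t₀, h₀, hq₀⟩ := hv
      obtain ⟨E, hE⟩ := exists_isSome_of_tendsto (g := fun i => (γ₀ i).2.1.1) h₀.2.2.2.2.2.1 t₀
      refine ⟨E, fun γ x y h t ht => ?_⟩
      by_contra! hcon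
      have key : ∀ s ≤ E, (γ (t + s)).1 = (γ₀ (t₀ + s)).1 := by
        intro s
        induction s with
        | zero => intro _; exact ht.trans hq₀.symm
        | succ s ih =>
          intro hs
          have hsrc := ih (by omega)
          have hl := hcon s (by omega)
          simp only [lsupp, Prod.mk.injEq, Option.isSome_eq_false_iff, Option.isNone_iff_eq_none]
            at hl
          have : γ (t + s) = γ₀ (t₀ + s) :=
            hC.eq_of_labels (h.2.1 _) (h₀.2.1 _) hsrc (by simp [hl.1]) (by simp [hl.2])
          rw [← add_assoc, ← add_assoc, ← h.2.2.1, ← h₀.2.2.1, this]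
      have h1 := (hC _ (h.2.1 _) _ (h₀.2.1 _) (key E le_rfl)).1
      rw [hcon E le_rfl] at h1
      have h2 := congrArg Prod.fst h1
      simp only [lsupp] at h2
      simp [← h2] at hE
    · push Not at hv
      exact ⟨0, fun γ x y h t ht => absurd ht (hv γ x y t h)⟩
  choose E hE using hq
  obtain ⟨M, hM⟩ := (Set.finite_range E).bddAbove
  refine ⟨M, fun γ x y h t => ?_⟩
  obtain ⟨s, hs, hs'⟩ := hE _ γ x y h t rfl
  exact ⟨s, hs.trans (hM ⟨_, rfl⟩), hs'⟩

theorem le_mul_of_delay {E : ℕ}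
    (hE : ∀ t, ∃ s ≤ E, lsupp (γ (t + s)).2.1 ≠ (false, false)) (T : ℕ) :
    T < (E + 1) * ((c3in1 γ T).length + (c3in2 γ T).length + 1) := by
  have hstep : ∀ t, (c3in1 γ t).length + (c3in2 γ t).length + 1 ≤
      (c3in1 γ (t + (E + 1))).length + (c3in2 γ (t + (E + 1))).length := by
    intro t
    obtain ⟨s, hs, hne⟩ := hE t
    have h1 : (c3in1 γ t).length ≤ (c3in1 γ (t + s)).length := c3in1_length_mono γ (by omega)
    have h2 : (c3in2 γ t).length ≤ (c3in2 γ (t + s)).length := c3in2_length_mono γ (by omega)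
    have h3 : (c3in1 γ (t + s + 1)).length ≤ (c3in1 γ (t + (E + 1))).length :=
      c3in1_length_mono γ (by omega)
    have h4 : (c3in2 γ (t + s + 1)).length ≤ (c3in2 γ (t + (E + 1))).length :=
      c3in2_length_mono γ (by omega)
    rw [c3in1_length_succ] at h3
    rw [c3in2_length_succ] at h4
    have h5 : 1 ≤ (γ (t + s)).2.1.1.toList.length + (γ (t + s)).2.1.2.toList.length := by
      cases h6 : (γ (t + s)).2.1.1 <;> cases h7 : (γ (t + s)).2.1.2 <;> simp_all [lsupp]
    omega
  induction T using Nat.strong_induction_on with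
  | _ T ih =>
    rcases lt_or_ge T (E + 1) with h | h
    · nlinarith
    · obtain ⟨t, rfl⟩ := Nat.exists_eq_add_of_le' h
      have h1 := ih t (by omega)
      have h2 := hstep t
      nlinarith

end AccRun

/-! ### Synchronizing words -/

/-- Every run that reads `v` on the second tape from the state `q` meanwhile reads a symbol
from the first tape. -/
def Comp3.Hits (C : Comp3 A B D Q) (v : List B) (q : Q) : Prop :=
  ∀ γ x y, C.IsAccRunOn γ x y → ∀ t, (γ t).1 = q →
    (∀ j b, v[j]? = some b → y ((c3in2 γ t).length + j) = b) →
    ∃ t' ≥ t, (γ t').2.1.1.isSome = true ∧ (c3in2 γ t').length < (c3in2 γ t).length + v.length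

theorem Comp3.Hits.mono {C : Comp3 A B D Q} {v w : List B} {q : Q} (h : C.Hits v q)
    (hvw : v <+: w) : C.Hits w q := by
  intro γ x y hγ t ht hw
  obtain ⟨t', ht', h1, h2⟩ := h γ x y hγ t ht fun j b hb => hw j b (by
    obtain ⟨u, rfl⟩ := hvw
    rw [List.getElem?_append_left (List.getElem?_eq_some_iff.1 hb).1, hb])
  exact ⟨t', ht', h1, h2.trans_le (Nat.add_le_add_left hvw.length_le _)⟩

theorem Comp3.TwoDet.exists_prefix_hits {C : Comp3 A B D Q} (hC : C.TwoDet) (v : List B) (q : Q) :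
    ∃ w, v <+: w ∧ C.Hits w q := by
  classical
  by_cases hv : C.Hits v q
  · exact ⟨v, List.prefix_rfl, hv⟩
  unfold Comp3.Hits at hv
  push Not at hv
  obtain ⟨γ, x, y, h, t, hq, hvy, hno⟩ := hv
  have hex := exists_isSome_of_tendsto (g := fun i => (γ i).2.1.1) h.2.2.2.2.2.1 t
  set s := Nat.find hex with hs
  have hsome : (γ (t + s)).2.1.1.isSome = true := Nat.find_spec hex
  have hnone : ∀ r < s, (γ (t + r)).2.1.1 = none := fun r hr => by
    simpa using Nat.find_min hex hr
  have hge := hno (t + s) (by omega) hsome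
  set p := (c3in2 γ t).length with hp
  set k := (c3in2 γ (t + s)).length + 1 - p with hk
  refine ⟨pref (fun j => y (p + j)) k, ?_, ?_⟩
  · rw [List.prefix_iff_getElem?]
    intro j hj
    rw [pref_getElem? _ (by omega), hvy j _ (List.getElem?_eq_getElem hj)]
  · intro γ₁ x₁ y₁ h₁ t₁ hq₁ hw
    have hw' : ∀ j < k, y₁ ((c3in2 γ₁ t₁).length + j) = y (p + j) := fun j hj =>
      hw j _ (pref_getElem? _ hj)
    set p₁ := (c3in2 γ₁ t₁).length with hp₁
    have key : ∀ r ≤ s, (γ₁ (t₁ + r)).1 = (γ (t + r)).1 ∧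
        (c3in2 γ₁ (t₁ + r)).length + p = (c3in2 γ (t + r)).length + p₁ := by
      intro r
      induction r with
      | zero => intro _; exact ⟨hq₁.trans hq.symm, by simp only [add_zero]; omega⟩
      | succ r ih =>
        intro hr
        obtain ⟨hsrc, hpos⟩ := ih (by omega)
        have hm : (c3in2 γ (t + r)).length ≤ (c3in2 γ (t + s)).length :=
          c3in2_length_mono γ (by omega)
        have hm' : p ≤ (c3in2 γ (t + r)).length := c3in2_length_mono γ (by omega)
        have heq : γ₁ (t₁ + r) = γ (t + r) := by
          refine hC.eq_of_labels (h₁.2.1 _) (h.2.1 _) hsrc ?_ ?_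
          · intro a a' _ ha'
            rw [hnone r (by omega)] at ha'
            cases ha'
          · intro b b' hb hb'
            rw [← h₁.symbol2 hb, ← h.symbol2 hb']
            have := hw' ((c3in2 γ (t + r)).length - p) (by omega)
            rwa [show p₁ + ((c3in2 γ (t + r)).length - p) = (c3in2 γ₁ (t₁ + r)).length by omega,
              show p + ((c3in2 γ (t + r)).length - p) = (c3in2 γ (t + r)).length by omega] at this
        rw [← add_assoc, ← add_assoc, c3in2_length_succ, c3in2_length_succ, ← h₁.2.2.1,
          ← h.2.2.1, heq]
        exact ⟨rfl, by omega⟩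
    obtain ⟨hsrc, hpos⟩ := key s le_rfl
    refine ⟨t₁ + s, by omega, ?_, ?_⟩
    · have h1 := congrArg Prod.fst (hC _ (h₁.2.1 _) _ (h.2.1 _) hsrc).1
      exact h1.trans hsome
    · rw [pref_length]
      omega

theorem Comp3.TwoDet.exists_hits_all [Finite Q] [Nonempty B] {C : Comp3 A B D Q}
    (hC : C.TwoDet) : ∃ v : List B, v ≠ [] ∧ ∀ q, C.Hits v q := by
  classical
  cases nonempty_fintype Q
  have h : ∀ s : Finset Q, ∃ v : List B, v ≠ [] ∧ ∀ q ∈ s, C.Hits v q := by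
    intro s
    induction s using Finset.induction_on with
    | empty => exact ⟨[Classical.arbitrary B], by simp, by simp⟩
    | insert q s _ ih =>
      obtain ⟨v, hv, hvs⟩ := ih
      obtain ⟨w, hvw, hw⟩ := hC.exists_prefix_hits v q
      refine ⟨w, fun h0 => hv (List.prefix_nil.1 (h0 ▸ hvw)), fun r hr => ?_⟩
      rcases Finset.mem_insert.1 hr with rfl | hr
      · exact hw
      · exact (hvs r hr).mono hvw
  obtain ⟨v, hv, hq⟩ := h Finset.univ
  exact ⟨v, hv, fun q => hq q (Finset.mem_univ q)⟩

theorem Comp3.IsAccRunOn.blockOcc_le {C : Comp3 A B D Q}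
    {γ : ℕ → Q × (Option A × Option B) × List D × Q} {x : ℕ → A} {y : ℕ → B}
    (h : C.IsAccRunOn γ x y) {v : List B} (hv : v ≠ []) (hits : ∀ q, C.Hits v q) (T : ℕ) :
    blockOcc y v.get ((c3in2 γ T).length / v.length) ≤ (c3in1 γ T).length := by
  classical
  have hℓ : 0 < v.length := List.length_pos_iff.2 hv
  rw [show (c3in1 γ T).length = _ from optWord_length_eq_card (fun i => (γ i).2.1.1) T, blockOcc]
  refine Finset.card_le_card_of_surjOn (fun t => (c3in2 γ t).length / v.length) ?_
  intro k hk
  simp only [Finset.coe_filter, Finset.mem_range, Set.mem_ofPred_eq] at hk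
  obtain ⟨hkT, hkv⟩ := hk
  obtain ⟨t, ht⟩ := exists_optWord_length_eq (g := fun i => (γ i).2.1.2) h.2.2.2.2.2.2.1
    (k * v.length)
  replace ht : (c3in2 γ t).length = k * v.length := ht
  obtain ⟨t', htt', hsome, hlt⟩ := hits _ γ x y h t rfl (by
    intro j b hb
    obtain ⟨hj, hb⟩ := List.getElem?_eq_some_iff.1 hb
    rw [ht, hkv ⟨j, hj⟩]
    exact hb)
  rw [ht] at hlt
  have h1 : (c3in2 γ t).length ≤ (c3in2 γ t').length := c3in2_length_mono γ htt'
  have h2 : (k + 1) * v.length ≤ (c3in2 γ T).length :=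
    (Nat.mul_le_mul_right _ hkT).trans (Nat.div_mul_le_self _ _)
  refine ⟨t', ?_, ?_⟩
  · simp only [Finset.coe_filter, Finset.mem_range, Set.mem_ofPred_eq]
    refine ⟨?_, hsome⟩
    by_contra! hcon
    have h3 : (c3in2 γ T).length ≤ (c3in2 γ t').length := c3in2_length_mono γ hcon
    nlinarith
  · exact Nat.div_eq_of_lt_le (by omega) (by rw [Nat.succ_mul]; exact hlt)

/-- If every block has a positive frequency in the second input then the first input is read
at a linear rate. -/
theorem Comp3.IsAccRunOn.exists_le_mul [Finite Q] [Nonempty B] {C : Comp3 A B D Q}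
    {γ : ℕ → Q × (Option A × Option B) × List D × Q} {x : ℕ → A} {y : ℕ → B}
    (h : C.IsAccRunOn γ x y) (hC : C.TwoDet)
    (hy : ∀ ℓ, 0 < ℓ → ∀ u : Fin ℓ → B, ∃ c : ℝ, 0 < c ∧
      Tendsto (fun n : ℕ => (blockOcc y u n : ℝ) / n) atTop (𝓝 c)) :
    ∃ K : ℕ, ∀ᶠ n in atTop, n ≤ K * (c3in1 γ n).length := by
  obtain ⟨v, hv, hits⟩ := hC.exists_hits_all
  have hℓ : 0 < v.length := List.length_pos_iff.2 hv
  obtain ⟨E, hE⟩ := hC.exists_delay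
  obtain ⟨c, hc, hlim⟩ := hy v.length hℓ v.get
  obtain ⟨M, hM⟩ := exists_nat_gt (2 / c)
  have hocc : ∀ᶠ n : ℕ in atTop, n ≤ M * blockOcc y v.get n := by
    filter_upwards [hlim.eventually (lt_mem_nhds (half_lt_self hc)), eventually_gt_atTop 0]
      with n hn hn0
    have hn0' : (0 : ℝ) < n := by exact_mod_cast hn0
    rw [lt_div_iff₀ hn0'] at hn
    rw [div_lt_iff₀ hc] at hM
    have : (n : ℝ) ≤ M * blockOcc y v.get n := by
      have h1 : (M : ℝ) * (c / 2 * n) ≤ M * blockOcc y v.get n :=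
        mul_le_mul_of_nonneg_left hn.le (Nat.cast_nonneg _)
      nlinarith
    exact_mod_cast this
  have hT : Tendsto (fun n => (c3in2 γ n).length / v.length) atTop atTop :=
    (Nat.tendsto_div_const_atTop hℓ.ne').comp h.2.2.2.2.2.2.1
  refine ⟨(E + 1) * (v.length * M + v.length + 2), ?_⟩
  filter_upwards [hT.eventually hocc, h.2.2.2.2.2.1.eventually (eventually_ge_atTop 1)]
    with n hn h1
  have h2 := h.blockOcc_le hv hits n
  have h3 := le_mul_of_delay (hE γ x y h) n
  have h4 : (c3in2 γ n).length ≤ v.length * (M * (c3in1 γ n).length + 1) := by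
    have h5 := Nat.lt_mul_div_succ (c3in2 γ n).length hℓ
    have h6 : (c3in2 γ n).length / v.length ≤ M * (c3in1 γ n).length :=
      hn.trans (Nat.mul_le_mul_left _ h2)
    exact h5.le.trans (Nat.mul_le_mul_left _ (by omega))
  refine h3.le.trans ?_
  rw [mul_assoc]
  refine Nat.mul_le_mul_left _ ?_
  nlinarith

/-! ### Simulation of a conditional compressor on finite words -/

open Classical in
/-- A transition of `C` starting in `q` whose input labels are compatible with the next available
input symbols `α` and `β`. -/
noncomputable def Comp3.next (C : Comp3 A B D Q) (q : Q) (α : Option A) (β : Option B) :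
    Option (Q × (Option A × Option B) × List D × Q) :=
  if h : ∃ t ∈ C.trans, t.1 = q ∧ (∀ a, t.2.1.1 = some a → α = some a) ∧
      ∀ b, t.2.1.2 = some b → β = some b then some h.choose else none

theorem Comp3.next_spec {C : Comp3 A B D Q} {q : Q} {α : Option A} {β : Option B}
    {t : Q × (Option A × Option B) × List D × Q} (h : C.next q α β = some t) :
    t ∈ C.trans ∧ t.1 = q ∧ (∀ a, t.2.1.1 = some a → α = some a) ∧
      ∀ b, t.2.1.2 = some b → β = some b := by
  unfold Comp3.next at h
  split_ifs at h with hex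
  · rw [← Option.some.inj h]
    exact hex.choose_spec

theorem Comp3.TwoDet.next_eq {C : Comp3 A B D Q} (hC : C.TwoDet)
    {t : Q × (Option A × Option B) × List D × Q} (ht : t ∈ C.trans) {α : A} {β : B}
    (hα : ∀ a, t.2.1.1 = some a → α = a) (hβ : ∀ b, t.2.1.2 = some b → β = b) :
    C.next t.1 (some α) (some β) = some t := by
  have hex : ∃ t' ∈ C.trans, t'.1 = t.1 ∧ (∀ a, t'.2.1.1 = some a → some α = some a) ∧
      ∀ b, t'.2.1.2 = some b → some β = some b :=
    ⟨t, ht, rfl, fun a ha => congrArg some (hα a ha), fun b hb => congrArg some (hβ b hb)⟩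
  unfold Comp3.next
  rw [dif_pos hex]
  obtain ⟨h1, h2, h3, h4⟩ := hex.choose_spec
  refine congrArg some (hC.eq_of_labels h1 ht h2 ?_ ?_)
  · intro a a' ha ha'
    rw [← hα a' ha', Option.some.inj (h3 a ha)]
  · intro b b' hb hb'
    rw [← hβ b' hb', Option.some.inj (h4 b hb)]

/-- New state, together with the increments of the two input positions and of the output length;
the state is `none` when the simulation is stuck. -/
noncomputable def Comp3.delta (C : Comp3 A B D Q) (s : Option Q) (α : Option A) (β : Option B) :
    Option Q × ℕ × ℕ × ℕ :=
  match s.bind fun q => C.next q α β with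
  | none => (none, 0, 0, 0)
  | some t => (some t.2.2.2, t.2.1.1.toList.length, t.2.1.2.toList.length, t.2.2.1.length)

/-- One step of the simulation of `C` on the input words `X` and `Y`. A configuration consists of
the state, the two input positions and the output length. -/
noncomputable def Comp3.simStep (C : Comp3 A B D Q) (X : List A) (Y : List B)
    (c : Option Q × ℕ × ℕ × ℕ) : Option Q × ℕ × ℕ × ℕ :=
  ((C.delta c.1 X[c.2.1]? Y[c.2.2.1]?).1,
    c.2.1 + (C.delta c.1 X[c.2.1]? Y[c.2.2.1]?).2.1,
    c.2.2.1 + (C.delta c.1 X[c.2.1]? Y[c.2.2.1]?).2.2.1,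
    c.2.2.2 + (C.delta c.1 X[c.2.1]? Y[c.2.2.1]?).2.2.2)

/-- The configuration of `C` on the input words `X` and `Y` after `n` steps. -/
noncomputable def Comp3.sim (C : Comp3 A B D Q) (X : List A) (Y : List B) (n : ℕ) :
    Option Q × ℕ × ℕ × ℕ :=
  (C.simStep X Y)^[n] (some C.init, 0, 0, 0)

theorem Comp3.sim_succ (C : Comp3 A B D Q) (X : List A) (Y : List B) (n : ℕ) :
    C.sim X Y (n + 1) = C.simStep X Y (C.sim X Y n) := Function.iterate_succ_apply' _ _ _

theorem Comp3.primrec_sim [Finite A] [Finite B] [Finite Q] [Primcodable A] [Primcodable B]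
    [Primcodable Q] (C : Comp3 A B D Q) :
    Primrec fun p : List A × List B => C.sim p.1 p.2 p.1.length := by
  have hδ : Primrec fun p : Option Q × Option A × Option B => C.delta p.1 p.2.1 p.2.2 :=
    Primrec.dom_finite _
  have hX : Primrec fun p : (List A × List B) × (Option Q × ℕ × ℕ × ℕ) => p.1.1[p.2.2.1]? :=
    Primrec.list_getElem?.comp (Primrec.fst.comp Primrec.fst)
      (Primrec.fst.comp (Primrec.snd.comp Primrec.snd))
  have hY : Primrec fun p : (List A × List B) × (Option Q × ℕ × ℕ × ℕ) => p.1.2[p.2.2.2.1]? :=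
    Primrec.list_getElem?.comp (Primrec.snd.comp Primrec.fst)
      (Primrec.fst.comp (Primrec.snd.comp (Primrec.snd.comp Primrec.snd)))
  have hd : Primrec fun p : (List A × List B) × (Option Q × ℕ × ℕ × ℕ) =>
      C.delta p.2.1 p.1.1[p.2.2.1]? p.1.2[p.2.2.2.1]? :=
    hδ.comp (Primrec.pair (Primrec.fst.comp Primrec.snd) (Primrec.pair hX hY))
  have hstep : Primrec₂ fun (p : List A × List B) (c : Option Q × ℕ × ℕ × ℕ) =>
      C.simStep p.1 p.2 c := by
    refine Primrec.pair (Primrec.fst.comp hd) (Primrec.pair ?_ (Primrec.pair ?_ ?_))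
    · exact Primrec.nat_add.comp (Primrec.fst.comp (Primrec.snd.comp Primrec.snd))
        (Primrec.fst.comp (Primrec.snd.comp hd))
    · exact Primrec.nat_add.comp (Primrec.fst.comp (Primrec.snd.comp (Primrec.snd.comp Primrec.snd)))
        (Primrec.fst.comp (Primrec.snd.comp (Primrec.snd.comp hd)))
    · exact Primrec.nat_add.comp (Primrec.snd.comp (Primrec.snd.comp (Primrec.snd.comp Primrec.snd)))
        (Primrec.snd.comp (Primrec.snd.comp (Primrec.snd.comp hd)))
  exact Primrec.nat_iterate (Primrec.list_length.comp Primrec.fst) (Primrec.const _) hstep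

theorem Comp3.IsAccRunOn.sim_pref {C : Comp3 A B D Q}
    {γ : ℕ → Q × (Option A × Option B) × List D × Q} {x : ℕ → A} {y : ℕ → B}
    (h : C.IsAccRunOn γ x y) (hC : C.TwoDet) (N : ℕ) {n : ℕ} (hn : n ≤ N) :
    C.sim (pref x N) (pref y N) n =
      (some (γ n).1, (c3in1 γ n).length, (c3in2 γ n).length, (c3out γ n).length) := by
  induction n with
  | zero => simp [Comp3.sim, h.1, c3in1, c3in2, c3out]
  | succ n ih =>
    have h1 := c3in1_length_le γ n
    have h2 := c3in2_length_le γ n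
    have hδ : C.delta (some (γ n).1) (pref x N)[(c3in1 γ n).length]?
        (pref y N)[(c3in2 γ n).length]? = (some (γ n).2.2.2, (γ n).2.1.1.toList.length,
          (γ n).2.1.2.toList.length, (γ n).2.2.1.length) := by
      rw [pref_getElem? _ (by omega), pref_getElem? _ (by omega), Comp3.delta, Option.bind_some,
        hC.next_eq (h.2.1 n) (fun a ha => h.symbol1 ha) fun b hb => h.symbol2 hb]
    rw [C.sim_succ, ih (by omega), Comp3.simStep, hδ, c3in1_length_succ, c3in2_length_succ,
      c3out_succ, List.length_append, h.2.2.1]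

/-- The transition used in the step `n` of the simulation. -/
noncomputable def Comp3.simRun (C : Comp3 A B D Q) (X : List A) (Y : List B) (n : ℕ) :
    Q × (Option A × Option B) × List D × Q :=
  ((C.sim X Y n).1.bind fun q => C.next q X[(C.sim X Y n).2.1]? Y[(C.sim X Y n).2.2.1]?).getD
    (C.init, (none, none), [], C.init)

theorem Comp3.sim_of_succ {C : Comp3 A B D Q} {X : List A} {Y : List B} {n : ℕ} {q' : Q}
    (h : (C.sim X Y (n + 1)).1 = some q') :
    (C.sim X Y n).1 = some (C.simRun X Y n).1 ∧ C.simRun X Y n ∈ C.trans ∧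
      (∀ a, (C.simRun X Y n).2.1.1 = some a → X[(C.sim X Y n).2.1]? = some a) ∧
      (∀ b, (C.simRun X Y n).2.1.2 = some b → Y[(C.sim X Y n).2.2.1]? = some b) ∧
      C.sim X Y (n + 1) = (some (C.simRun X Y n).2.2.2,
        (C.sim X Y n).2.1 + (C.simRun X Y n).2.1.1.toList.length,
        (C.sim X Y n).2.2.1 + (C.simRun X Y n).2.1.2.toList.length,
        (C.sim X Y n).2.2.2 + (C.simRun X Y n).2.2.1.length) := by
  rw [C.sim_succ] at h ⊢
  unfold Comp3.simStep Comp3.delta at h ⊢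
  unfold Comp3.simRun
  cases ht : (C.sim X Y n).1.bind fun q =>
      C.next q X[(C.sim X Y n).2.1]? Y[(C.sim X Y n).2.2.1]? with
  | none => rw [ht] at h; cases h
  | some t =>
    obtain ⟨q, hq, hn⟩ := Option.bind_eq_some_iff.1 ht
    obtain ⟨h1, h2, h3, h4⟩ := Comp3.next_spec hn
    simp only [Option.getD_some]
    exact ⟨by rw [hq, h2], h1, h3, h4, trivial⟩

theorem Comp3.sim_alive {C : Comp3 A B D Q} {X : List A} {Y : List B} {n : ℕ}
    (h : (C.sim X Y n).1.isSome = true) {k : ℕ} (hk : k ≤ n) :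
    (C.sim X Y k).1.isSome = true := by
  induction n with
  | zero => rwa [Nat.le_zero.1 hk]
  | succ n ih =>
    rcases Nat.le_succ_iff.1 hk with hk | rfl
    · obtain ⟨q', hq'⟩ := Option.isSome_iff_exists.1 h
      exact ih (by rw [(Comp3.sim_of_succ hq').1]; rfl) hk
    · exact h

theorem Comp3.sim_eq {C : Comp3 A B D Q} {X : List A} {Y : List B} {n : ℕ}
    (h : (C.sim X Y n).1.isSome = true) :
    (C.sim X Y n).2 = ((c3in1 (C.simRun X Y) n).length, (c3in2 (C.simRun X Y) n).length,
      (c3out (C.simRun X Y) n).length) := by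
  induction n with
  | zero => simp [Comp3.sim, c3in1, c3in2, c3out]
  | succ n ih =>
    obtain ⟨q', hq'⟩ := Option.isSome_iff_exists.1 h
    rw [(Comp3.sim_of_succ hq').2.2.2.2, ih (Comp3.sim_alive h n.le_succ), c3in1_length_succ,
      c3in2_length_succ, c3out_succ, List.length_append]

/-! ### Continuing a finite run -/

/-- The sequence that agrees with `g` before `n` and continues as `g'` from the index `t`. -/
def glue {α : Type*} (g g' : ℕ → α) (n t k : ℕ) : α := if k < n then g k else g' (t + (k - n))

theorem glue_of_lt {α : Type*} (g g' : ℕ → α) {n k : ℕ} (t : ℕ) (h : k < n) :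
    glue g g' n t k = g k := if_pos h

theorem glue_add {α : Type*} (g g' : ℕ → α) (n t r : ℕ) :
    glue g g' n t (n + r) = g' (t + r) := by simp [glue]

theorem map_glue {α β : Type*} (f : α → β) (g g' : ℕ → α) (n t : ℕ) :
    (fun k => f (glue g g' n t k)) = glue (fun k => f (g k)) (fun k => f (g' k)) n t := by
  funext k
  unfold glue
  split_ifs <;> rfl

theorem optWord_glue_of_le (g g' : ℕ → Option A) {n k : ℕ} (t : ℕ) (h : k ≤ n) :
    optWord (glue g g' n t) k = optWord g k :=
  optWord_congr fun _ hi => glue_of_lt g g' t (hi.trans_le h)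

theorem optWord_glue_add (g g' : ℕ → Option A) (n t r : ℕ) :
    (optWord (glue g g' n t) (n + r)).length + (optWord g' t).length =
      (optWord g n).length + (optWord g' (t + r)).length := by
  induction r with
  | zero => simp [optWord_glue_of_le]
  | succ r ih =>
    rw [← add_assoc, ← add_assoc, optWord_length_succ, optWord_length_succ, glue_add]
    omega

theorem tendsto_optWord_glue {g' : ℕ → Option A}
    (h : Tendsto (fun n => (optWord g' n).length) atTop atTop) (g : ℕ → Option A) (n t : ℕ) :
    Tendsto (fun k => (optWord (glue g g' n t) k).length) atTop atTop := by
  refine tendsto_atTop.2 fun b => ?_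
  obtain ⟨N, hN⟩ := eventually_atTop.1 (tendsto_atTop.1 h (b + (optWord g' t).length))
  filter_upwards [eventually_ge_atTop (n + N)] with k hk
  obtain ⟨r, rfl⟩ := Nat.exists_eq_add_of_le ((Nat.le_add_right n N).trans hk)
  have h1 := optWord_glue_add g g' n t r
  have h2 := hN (t + r) (by omega)
  omega

theorem optWord_glue_symbol {g g' : ℕ → Option A} {z x' : ℕ → A} {n t : ℕ}
    (h : ∀ k < n, ∀ a, g k = some a → z (optWord g k).length = a)
    (h' : ∀ k a, g' k = some a → x' (optWord g' k).length = a) (k : ℕ) (a : A)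
    (hk : glue g g' n t k = some a) :
    glue z x' (optWord g n).length (optWord g' t).length (optWord (glue g g' n t) k).length = a := by
  rcases lt_or_ge k n with hkn | hkn
  · rw [glue_of_lt g g' t hkn] at hk
    rw [optWord_glue_of_le g g' t hkn.le, glue_of_lt, h k hkn a hk]
    have h1 := optWord_length_succ g k
    rw [hk, Option.toList_some, List.length_singleton] at h1
    have h2 : (optWord g (k + 1)).length ≤ (optWord g n).length := optWord_length_mono g hkn
    omega
  · obtain ⟨r, rfl⟩ := Nat.exists_eq_add_of_le hkn
    rw [glue_add] at hk
    have h1 := optWord_glue_add g g' n t r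
    have h2 : (optWord g' t).length ≤ (optWord g' (t + r)).length :=
      optWord_length_mono g' (by omega)
    obtain ⟨s, hs⟩ := Nat.exists_eq_add_of_le h2
    rw [show (optWord (glue g g' n t) (n + r)).length = (optWord g n).length + s by omega,
      glue_add, ← hs, h' _ a hk]

theorem c3out_glue_of_le (γ γ' : ℕ → Q × (Option A × Option B) × List D × Q) {n k : ℕ} (t : ℕ)
    (h : k ≤ n) : c3out (glue γ γ' n t) k = c3out γ k := by
  unfold c3out
  congr 1
  refine List.map_congr_left fun i hi => ?_
  rw [glue_of_lt γ γ' t ((List.mem_range.1 hi).trans_le h)]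

theorem c3out_glue_add (γ γ' : ℕ → Q × (Option A × Option B) × List D × Q) (n t r : ℕ) :
    c3out (glue γ γ' n t) (n + r) = c3out γ n ++ c3out (fun k => γ' (t + k)) r := by
  induction r with
  | zero => rw [add_zero, c3out_glue_of_le γ γ' t le_rfl]; simp [c3out]
  | succ r ih => rw [← add_assoc, c3out_succ, ih, glue_add, c3out_succ, List.append_assoc]

theorem c3out_add (γ : ℕ → Q × (Option A × Option B) × List D × Q) (t r : ℕ) :
    c3out γ (t + r) = c3out γ t ++ c3out (fun k => γ (t + k)) r := by
  induction r with
  | zero => simp [c3out]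
  | succ r ih => rw [← add_assoc, c3out_succ, ih, c3out_succ, List.append_assoc]

/-- A simulated finite run that ends in the state reached by an accepting run at time `t` can be
continued to an accepting run. -/
theorem Comp3.IsAccRunOn.glue_simRun {C : Comp3 A B D Q}
    {γ : ℕ → Q × (Option A × Option B) × List D × Q} {x : ℕ → A} {y : ℕ → B}
    (h : C.IsAccRunOn γ x y) {X : List A} {Y : List B} {n t : ℕ} (a₀ : A) (b₀ : B)
    (ht : (C.sim X Y n).1 = some (γ t).1) :
    C.IsAccRunOn (glue (C.simRun X Y) γ n t)
      (glue (fun p => X[p]?.getD a₀) x (C.sim X Y n).2.1 (c3in1 γ t).length)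
      (glue (fun p => Y[p]?.getD b₀) y (C.sim X Y n).2.2.1 (c3in2 γ t).length) := by
  have hn : (C.sim X Y n).1.isSome = true := by rw [ht]; rfl
  have hstep : ∀ k < n, ∃ q', (C.sim X Y (k + 1)).1 = some q' := fun k hk =>
    Option.isSome_iff_exists.1 (Comp3.sim_alive hn hk)
  have hsrc : ∀ k ≤ n, (C.sim X Y k).1 = some (glue (C.simRun X Y) γ n t k).1 := by
    intro k hk
    rcases hk.lt_or_eq with hk | rfl
    · obtain ⟨q', hq'⟩ := hstep k hk
      rw [glue_of_lt _ _ _ hk, (Comp3.sim_of_succ hq').1]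
    · have := glue_add (C.simRun X Y) γ k t 0
      simp only [add_zero] at this
      rw [this, ht]
  have hsim := Comp3.sim_eq hn
  have hi : (C.sim X Y n).2.1 = (c3in1 (C.simRun X Y) n).length := by rw [hsim]
  have hj : (C.sim X Y n).2.2.1 = (c3in2 (C.simRun X Y) n).length := by rw [hsim]
  have e1 : (fun i => (glue (C.simRun X Y) γ n t i).2.1.1) =
      glue (fun i => (C.simRun X Y i).2.1.1) (fun i => (γ i).2.1.1) n t :=
    map_glue (fun τ : Q × (Option A × Option B) × List D × Q => τ.2.1.1) _ _ _ _
  have e2 : (fun i => (glue (C.simRun X Y) γ n t i).2.1.2) =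
      glue (fun i => (C.simRun X Y i).2.1.2) (fun i => (γ i).2.1.2) n t :=
    map_glue (fun τ : Q × (Option A × Option B) × List D × Q => τ.2.1.2) _ _ _ _
  have hc1 : c3in1 (glue (C.simRun X Y) γ n t) =
      optWord (glue (fun i => (C.simRun X Y i).2.1.1) (fun i => (γ i).2.1.1) n t) := by
    rw [← e1]; rfl
  have hc2 : c3in2 (glue (C.simRun X Y) γ n t) =
      optWord (glue (fun i => (C.simRun X Y i).2.1.2) (fun i => (γ i).2.1.2) n t) := by
    rw [← e2]; rfl
  refine ⟨?_, ?_, ?_, ?_, ?_, ?_, ?_, ?_⟩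
  · exact (Option.some.inj (hsrc 0 (Nat.zero_le _))).symm
  · intro k
    unfold glue
    split_ifs with hk
    · obtain ⟨q', hq'⟩ := hstep k hk
      exact (Comp3.sim_of_succ hq').2.1
    · exact h.2.1 _
  · intro k
    rcases lt_or_ge k n with hk | hk
    · obtain ⟨q', hq'⟩ := hstep k hk
      have h1 := hsrc (k + 1) hk
      rw [(Comp3.sim_of_succ hq').2.2.2.2] at h1
      rw [glue_of_lt _ _ _ hk, ← Option.some.inj h1]
    · obtain ⟨r, rfl⟩ := Nat.exists_eq_add_of_le hk
      rw [glue_add, add_assoc, glue_add, ← add_assoc, h.2.2.1]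
  · rw [hc1, hi]
    refine (optWord_eq_pref_iff _ _).2 (optWord_glue_symbol ?_ ?_)
    · intro k hk a ha
      obtain ⟨q', hq'⟩ := hstep k hk
      have h1 := (Comp3.sim_of_succ hq').2.2.1 a ha
      rw [Comp3.sim_eq (Comp3.sim_alive hn hk.le)] at h1
      exact (congrArg (fun o => o.getD a₀) h1).trans rfl
    · exact fun k a ha => h.symbol1 ha
  · rw [hc2, hj]
    refine (optWord_eq_pref_iff _ _).2 (optWord_glue_symbol ?_ ?_)
    · intro k hk b hb
      obtain ⟨q', hq'⟩ := hstep k hk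
      have h1 := (Comp3.sim_of_succ hq').2.2.2.1 b hb
      rw [Comp3.sim_eq (Comp3.sim_alive hn hk.le)] at h1
      exact (congrArg (fun o => o.getD b₀) h1).trans rfl
    · exact fun k b hb => h.symbol2 hb
  · rw [hc1]
    exact tendsto_optWord_glue h.2.2.2.2.2.1 _ _ _
  · rw [hc2]
    exact tendsto_optWord_glue h.2.2.2.2.2.2.1 _ _ _
  · refine tendsto_atTop.2 fun b => ?_
    obtain ⟨N, hN⟩ := eventually_atTop.1
      (tendsto_atTop.1 h.2.2.2.2.2.2.2 (b + (c3out γ t).length))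
    filter_upwards [eventually_ge_atTop (n + N)] with k hk
    obtain ⟨r, rfl⟩ := Nat.exists_eq_add_of_le ((Nat.le_add_right n N).trans hk)
    have h1 := congrArg List.length (c3out_glue_add (C.simRun X Y) γ n t r)
    have h2 := congrArg List.length (c3out_add γ t r)
    have h3 := hN (t + r) (by omega)
    rw [List.length_append] at h1 h2
    omega

/-- Two input words leading to the same configuration and the same output, with the same second
input, agree on the part that was read. -/
theorem Comp3.OneToOne.eq_of_simRun {C : Comp3 A B D Q} (hC : C.OneToOne)
    {γ : ℕ → Q × (Option A × Option B) × List D × Q} {x : ℕ → A} {y : ℕ → B}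
    (h : C.IsAccRunOn γ x y) {X X' : List A} {Y : List B} {n t : ℕ}
    (ht : (C.sim X Y n).1 = some (γ t).1) (hc : C.sim X' Y n = C.sim X Y n)
    (hout : c3out (C.simRun X' Y) n = c3out (C.simRun X Y) n) (a₀ : A) {p : ℕ}
    (hp : p < (C.sim X Y n).2.1) : X[p]?.getD a₀ = X'[p]?.getD a₀ := by
  have h1 := h.glue_simRun (X := X) (Y := Y) (n := n) (t := t) a₀ (y 0) ht
  have h2 := h.glue_simRun (X := X') (Y := Y) (n := n) (t := t) a₀ (y 0) (by rw [hc, ht])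
  rw [hc] at h2
  have hpre : ∀ X₁ X₂ : List A, c3out (C.simRun X₁ Y) n = c3out (C.simRun X₂ Y) n →
      ∀ k, ∃ m, c3out (glue (C.simRun X₁ Y) γ n t) k <+: c3out (glue (C.simRun X₂ Y) γ n t) m := by
    intro X₁ X₂ heq k
    refine ⟨n + k, ?_⟩
    rw [c3out_glue_add, ← heq, ← c3out_glue_add, add_comm n k, c3out_add]
    exact List.prefix_append _ _
  have h3 := congrFun (hC _ _ _ _ _ h1 h2 (hpre X X' hout.symm) (hpre X' X hout)) p
  rwa [glue_of_lt _ _ _ hp, glue_of_lt _ _ _ hp] at h3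

/-! ### Few pairs of words are compressed -/

theorem Comp3.TwoDet.finite_trans [Finite A] [Finite B] [Finite Q] {C : Comp3 A B D Q}
    (hC : C.TwoDet) : C.trans.Finite := by
  refine Set.Finite.of_finite_image (f := fun t => (t.1, t.2.1)) (Set.toFinite _) ?_
  intro t ht t' ht' h
  obtain ⟨h1, h2⟩ := Prod.mk.inj h
  exact (hC t ht t' ht' h1).2 h2

theorem Comp3.TwoDet.exists_output_le [Finite A] [Finite B] [Finite Q] {C : Comp3 A B D Q}
    (hC : C.TwoDet) : ∃ L : ℕ, ∀ t ∈ C.trans, t.2.2.1.length ≤ L := by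
  obtain ⟨L, hL⟩ := (hC.finite_trans.image fun t => t.2.2.1.length).bddAbove
  exact ⟨L, fun t ht => hL ⟨t, ht, rfl⟩⟩

theorem c3out_length_le {γ : ℕ → Q × (Option A × Option B) × List D × Q} {L n : ℕ}
    (h : ∀ k < n, (γ k).2.2.1.length ≤ L) : (c3out γ n).length ≤ L * n := by
  induction n with
  | zero => simp [c3out]
  | succ n ih =>
    rw [c3out_succ, List.length_append, Nat.mul_succ]
    exact add_le_add (ih fun k hk => h k (by omega)) (h n (by omega))

open Classical in
/-- Whether a state occurs in an accepting run. -/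
noncomputable def Comp3.isLive (C : Comp3 A B D Q) (s : Option Q) : Bool :=
  decide (∃ γ x y t, C.IsAccRunOn γ x y ∧ s = some (γ t).1)

/-- Test whether the run on `X` and `Y` reads a proportion at least `1 / (K + 1)` of `X`, and the
size of its output is at most `K / (K + 1)` times the size of the part of `X` that it reads. -/
noncomputable def Comp3.compressTest [Fintype A] [Fintype D] (C : Comp3 A B D Q) (K : ℕ)
    (X : List A) (Y : List B) : Bool :=
  C.isLive (C.sim X Y X.length).1 &&
    (decide (X.length ≤ (C.sim X Y X.length).2.1 * (K + 1)) &&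
      decide (Fintype.card D ^ ((C.sim X Y X.length).2.2.2 * (K + 1)) ≤
        Fintype.card A ^ ((C.sim X Y X.length).2.1 * K)))

theorem Comp3.primrec_compressTest [Fintype A] [Finite B] [Fintype D] [Finite Q] [Primcodable A]
    [Primcodable B] [Primcodable Q] (C : Comp3 A B D Q) (K : ℕ) :
    Primrec₂ (C.compressTest K) := by
  have hs := C.primrec_sim
  have hi : Primrec fun p : List A × List B => (C.sim p.1 p.2 p.1.length).2.1 :=
    Primrec.fst.comp (Primrec.snd.comp hs)
  have ho : Primrec fun p : List A × List B => (C.sim p.1 p.2 p.1.length).2.2.2 :=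
    Primrec.snd.comp (Primrec.snd.comp (Primrec.snd.comp hs))
  refine Primrec.and.comp ((Primrec.dom_finite C.isLive).comp (Primrec.fst.comp hs))
    (Primrec.and.comp ?_ ?_)
  · exact (Primrec.nat_le.comp (Primrec.list_length.comp Primrec.fst)
      (Primrec.nat_mul.comp hi (Primrec.const (K + 1)))).decide
  · exact (Primrec.nat_le.comp
      ((primrec_pow _).comp (Primrec.nat_mul.comp ho (Primrec.const (K + 1))))
      ((primrec_pow _).comp (Primrec.nat_mul.comp hi (Primrec.const K)))).decide

theorem Comp3.simRun_mem_trans {C : Comp3 A B D Q} {X : List A} {Y : List B} {n : ℕ}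
    (h : (C.sim X Y n).1.isSome = true) {k : ℕ} (hk : k < n) : C.simRun X Y k ∈ C.trans := by
  obtain ⟨q', hq'⟩ := Option.isSome_iff_exists.1 (Comp3.sim_alive h hk)
  exact (Comp3.sim_of_succ hq').2.1

/-- The number of pairs of words of length `n` that lead to a given configuration. -/
theorem Comp3.OneToOne.card_fiber_le [Fintype A] [Fintype B] [Fintype D] {C : Comp3 A B D Q}
    (hC : C.OneToOne) {n : ℕ} {c : Option Q × ℕ × ℕ × ℕ} (hc : C.isLive c.1 = true)
    (S : Finset ((Fin n → A) × (Fin n → B)))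
    (hS : ∀ p ∈ S, C.sim (List.ofFn p.1) (List.ofFn p.2) n = c) :
    S.card ≤ Fintype.card B ^ n * (Fintype.card D ^ c.2.2.2 * Fintype.card A ^ (n - c.2.1)) := by
  classical
  obtain ⟨γ, x, y, t, h, ht⟩ := of_decide_eq_true hc
  obtain ⟨d₀, -⟩ : ∃ _ : D, True := by
    obtain ⟨m, hm⟩ := (tendsto_atTop.1 h.2.2.2.2.2.2.2 1).exists
    exact ⟨(c3out γ m)[0], trivial⟩
  let out := fun p : (Fin n → A) × (Fin n → B) =>
    c3out (C.simRun (List.ofFn p.1) (List.ofFn p.2)) n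
  let F : (Fin n → A) × (Fin n → B) → (Fin n → B) × (Fin c.2.2.2 → D) × (Fin (n - c.2.1) → A) :=
    fun p => (p.2, fun r => (out p)[(r : ℕ)]?.getD d₀,
      fun r => (List.ofFn p.1)[c.2.1 + (r : ℕ)]?.getD (x 0))
  have hinj : Set.InjOn F S := by
    rintro ⟨X, Y⟩ hp ⟨X', Y'⟩ hp' hF
    have e1 := hS _ hp
    have e2 := hS _ hp'
    simp only [F, Prod.mk.injEq] at hF
    obtain ⟨rfl, hout, hsuf⟩ := hF
    simp only at e1 e2
    have hlen : ∀ Z : Fin n → A, C.sim (List.ofFn Z) (List.ofFn Y) n = c →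
        (out (Z, Y)).length = c.2.2.2 := by
      intro Z hZ
      have h1 := Comp3.sim_eq (C := C) (X := List.ofFn Z) (Y := List.ofFn Y) (n := n)
        (by rw [hZ, ht]; rfl)
      rw [hZ] at h1
      rw [h1]
    have hout' : out (X', Y) = out (X, Y) := by
      refine List.ext_getElem (by rw [hlen X e1, hlen X' e2]) fun r h1 h2 => ?_
      have h3 := congrFun hout ⟨r, by rw [← hlen X e1]; exact h2⟩
      simp only [List.getElem?_eq_getElem h1, List.getElem?_eq_getElem h2, Option.getD_some] at h3
      exact h3.symm
    refine Prod.ext (funext fun k => ?_) rfl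
    have hk : (List.ofFn X)[(k : ℕ)]?.getD (x 0) = (List.ofFn X')[(k : ℕ)]?.getD (x 0) := by
      rcases lt_or_ge (k : ℕ) c.2.1 with hlt | hge
      · exact hC.eq_of_simRun h (by rw [e1, ht]) (by rw [e1, e2]) hout' (x 0) (by rwa [e1])
      · have h3 := congrFun hsuf ⟨k - c.2.1, by have := k.2; omega⟩
        simpa only [Nat.add_sub_of_le hge] using h3
    simpa [List.getElem?_ofFn] using hk
  calc S.card ≤ Fintype.card ((Fin n → B) × (Fin c.2.2.2 → D) × (Fin (n - c.2.1) → A)) :=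
        (Finset.card_le_card_of_injOn F (fun _ _ => Finset.mem_univ _) hinj)
    _ = _ := by simp [Fintype.card_prod]

theorem mul_pow_le_of_compressed {b d K n i o : ℕ} (hb : 2 ≤ b) (hi : i ≤ n)
    (hin : n ≤ i * (K + 1)) (ho : d ^ (o * (K + 1)) ≤ b ^ (i * K)) :
    ((d ^ o * b ^ (n - i) : ℕ) : ℝ) ≤ b ^ n * Real.exp (-(Real.log b / (K + 1) ^ 2)) ^ n := by
  have hb0 : (0 : ℝ) < b := by positivity
  have hρ : Real.exp (-(Real.log b / (K + 1) ^ 2)) ^ ((K + 1) ^ 2) = (b : ℝ)⁻¹ := by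
    rw [← Real.exp_nat_mul]
    have : (((K + 1) ^ 2 : ℕ) : ℝ) * -(Real.log b / (K + 1) ^ 2) = -Real.log b := by
      push_cast
      field_simp
    rw [this, Real.exp_neg, Real.exp_log hb0]
  have hnat : (d ^ o * b ^ (n - i)) ^ ((K + 1) ^ 2) * b ^ n ≤ b ^ (n * (K + 1) ^ 2) := by
    obtain ⟨r, rfl⟩ := Nat.exists_eq_add_of_le hi
    calc (d ^ o * b ^ (i + r - i)) ^ ((K + 1) ^ 2) * b ^ (i + r)
        = (d ^ (o * (K + 1))) ^ (K + 1) * b ^ (r * (K + 1) ^ 2 + (i + r)) := by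
          rw [Nat.add_sub_cancel_left, mul_pow, ← pow_mul, ← pow_mul, ← pow_mul, mul_assoc,
            ← pow_add]
          ring_nf
      _ ≤ (b ^ (i * K)) ^ (K + 1) * b ^ (r * (K + 1) ^ 2 + (i + r)) := by gcongr
      _ = b ^ (i * K * (K + 1) + (r * (K + 1) ^ 2 + (i + r))) := by rw [← pow_mul, ← pow_add]
      _ ≤ b ^ ((i + r) * (K + 1) ^ 2) := Nat.pow_le_pow_right (by omega) (by nlinarith)
  refine (pow_le_pow_iff_left₀ (by positivity) (by positivity)
    (n := (K + 1) ^ 2) (by positivity)).1 ?_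
  rw [mul_pow, ← pow_mul (Real.exp _), mul_comm n, pow_mul (Real.exp _), hρ, ← pow_mul, inv_pow,
    ← div_eq_mul_inv, le_div_iff₀ (by positivity)]
  exact_mod_cast hnat

theorem Comp3.OneToOne.testCount_compressTest_le [Fintype A] [Fintype D] [Fintype Q]
    (hA : 2 ≤ Fintype.card A) {C : Comp3 A A D Q} (hC : C.OneToOne) {L : ℕ}
    (hL : ∀ t ∈ C.trans, t.2.2.1.length ≤ L) (K n : ℕ) :
    (testCount (C.compressTest K) n : ℝ) ≤
      ((Fintype.card Q + 1) * (L + 1)) * (n + 2) ^ 3 *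
        Real.exp (-(Real.log (Fintype.card A) / (K + 1) ^ 2)) ^ n *
          ((Fintype.card A * Fintype.card A : ℕ) : ℝ) ^ n := by
  classical
  set b := Fintype.card A
  set ρ := Real.exp (-(Real.log b / (K + 1) ^ 2))
  set S : Finset ((Fin n → A) × (Fin n → A)) :=
    {p | C.compressTest K (List.ofFn p.1) (List.ofFn p.2) = true} with hSdef
  have hmem : ∀ p ∈ S, C.isLive (C.sim (List.ofFn p.1) (List.ofFn p.2) n).1 = true ∧
      n ≤ (C.sim (List.ofFn p.1) (List.ofFn p.2) n).2.1 * (K + 1) ∧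
      Fintype.card D ^ ((C.sim (List.ofFn p.1) (List.ofFn p.2) n).2.2.2 * (K + 1)) ≤
        b ^ ((C.sim (List.ofFn p.1) (List.ofFn p.2) n).2.1 * K) := by
    intro p hp
    have h1 := (Finset.mem_filter.1 hp).2
    simpa [Comp3.compressTest] using h1
  have hconf : ∀ p ∈ S, (C.sim (List.ofFn p.1) (List.ofFn p.2) n).2.1 ≤ n ∧
      (C.sim (List.ofFn p.1) (List.ofFn p.2) n).2.2.1 ≤ n ∧
      (C.sim (List.ofFn p.1) (List.ofFn p.2) n).2.2.2 ≤ L * n := by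
    intro p hp
    have hal : (C.sim (List.ofFn p.1) (List.ofFn p.2) n).1.isSome = true := by
      obtain ⟨γ, x, y, t, h, ht⟩ := of_decide_eq_true (hmem p hp).1
      rw [ht]
      rfl
    rw [Comp3.sim_eq hal]
    exact ⟨c3in1_length_le _ _, c3in2_length_le _ _,
      c3out_length_le fun k hk => hL _ (Comp3.simRun_mem_trans hal hk)⟩
  have hcard := Finset.card_le_mul_card_image_of_maps_to (s := S)
    (f := fun p => C.sim (List.ofFn p.1) (List.ofFn p.2) n)
    (t := Finset.univ ×ˢ Finset.range (n + 1) ×ˢ Finset.range (n + 1) ×ˢ Finset.range (L * n + 1))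
    (fun p hp => by
      obtain ⟨h1, h2, h3⟩ := hconf p hp
      simp only [Finset.mem_product, Finset.mem_univ, Finset.mem_range, true_and]
      omega) ⌊(b : ℝ) ^ n * (b ^ n * ρ ^ n)⌋₊ (by
      intro c _
      rcases Finset.eq_empty_or_nonempty
        (S.filter fun p => C.sim (List.ofFn p.1) (List.ofFn p.2) n = c) with he | ⟨p, hp⟩
      · rw [he]
        simp
      · obtain ⟨hpS, hpc⟩ := Finset.mem_filter.1 hp
        obtain ⟨h1, h2, h3⟩ := hmem p hpS
        have h4 := (hconf p hpS).1
        rw [hpc] at h1 h2 h3 h4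
        have h5 := hC.card_fiber_le h1
          (S.filter fun p => C.sim (List.ofFn p.1) (List.ofFn p.2) n = c)
          fun p hp => (Finset.mem_filter.1 hp).2
        refine Nat.le_floor ((Nat.cast_le.2 h5).trans ?_)
        rw [Nat.cast_mul, Nat.cast_pow]
        exact mul_le_mul_of_nonneg_left (mul_pow_le_of_compressed hA h4 h2 h3) (by positivity))
  have hT : ((Finset.univ ×ˢ Finset.range (n + 1) ×ˢ Finset.range (n + 1) ×ˢ
      Finset.range (L * n + 1) : Finset (Option Q × ℕ × ℕ × ℕ)).card : ℝ) ≤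
        ((Fintype.card Q + 1) * (L + 1)) * (n + 2) ^ 3 := by
    simp only [Finset.card_product, Finset.card_univ, Fintype.card_option, Finset.card_range]
    have : (Fintype.card Q + 1) * ((n + 1) * ((n + 1) * (L * n + 1))) ≤
        (Fintype.card Q + 1) * (L + 1) * (n + 2) ^ 3 := by
      rw [mul_assoc]
      refine Nat.mul_le_mul_left _ ?_
      calc (n + 1) * ((n + 1) * (L * n + 1))
          ≤ (n + 2) * ((n + 2) * ((L + 1) * (n + 2))) := by
            refine Nat.mul_le_mul (by omega) (Nat.mul_le_mul (by omega) (by nlinarith))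
        _ = (L + 1) * (n + 2) ^ 3 := by ring
    exact_mod_cast this
  have hcard' : (S.card : ℝ) ≤ ((b : ℝ) ^ n * (b ^ n * ρ ^ n)) *
      (((Fintype.card Q + 1) * (L + 1)) * (n + 2) ^ 3) := by
    refine (Nat.cast_le.2 hcard).trans ?_
    rw [Nat.cast_mul]
    exact mul_le_mul (Nat.floor_le (by positivity)) hT (by positivity) (by positivity)
  have hS : testCount (C.compressTest K) n = S.card := by
    rw [testCount, hSdef]
  rw [hS]
  refine hcard'.trans (le_of_eq ?_)
  rw [Nat.cast_mul, mul_pow]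
  ring

/-- A passing pair is eventually not compressed by a factor `K / (K + 1)`. -/
theorem Passes.eventually_lt_output [Fintype A] [Fintype D] [Fintype Q] [Primcodable A]
    [Primcodable Q] (hA : 2 ≤ Fintype.card A) {x y : ℕ → A} (h : Passes x y)
    {C : Comp3 A A D Q} (hC : C.TwoDet) (hC' : C.OneToOne)
    {γ : ℕ → Q × (Option A × Option A) × List D × Q} (hγ : C.IsAccRunOn γ x y) {K : ℕ}
    (hK : ∀ᶠ n in atTop, n ≤ (K + 1) * (c3in1 γ n).length) :
    ∀ᶠ n in atTop, Fintype.card A ^ ((c3in1 γ n).length * K) <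
      Fintype.card D ^ ((c3out γ n).length * (K + 1)) := by
  obtain ⟨L, hL⟩ := hC.exists_output_le
  have hlog : 0 < Real.log (Fintype.card A) := Real.log_pos (by exact_mod_cast hA)
  have hsmall := testCount_eventually_small (P := C.compressTest K) (by omega : 0 < Fintype.card A)
    (Real.exp_pos _) (Real.exp_lt_one_iff.2 (by
      have : 0 < Real.log (Fintype.card A) / ((K : ℝ) + 1) ^ 2 := by positivity
      linarith : -(Real.log (Fintype.card A) / ((K : ℝ) + 1) ^ 2) < 0))
    (Eventually.of_forall (hC'.testCount_compressTest_le hA hL K))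
  filter_upwards [h _ (C.primrec_compressTest K) hsmall, hK] with n hn hKn
  by_contra! hcon
  have hsim := hγ.sim_pref hC n le_rfl
  have hlive : C.isLive (some (γ n).1) = true := by
    classical
    exact decide_eq_true ⟨γ, x, y, n, hγ, rfl⟩
  rw [mul_comm] at hKn
  simp [Comp3.compressTest, pref_length, hsim, hlive, hKn, hcon] at hn

/-- A passing pair cannot be compressed conditionally. -/
theorem Passes.one_le_liminf [Fintype A] [Fintype D] [Fintype Q] [Primcodable A]
    [Primcodable Q] (hA : 2 ≤ Fintype.card A) (hD : 2 ≤ Fintype.card D) {x y : ℕ → A}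
    (h : Passes x y) {C : Comp3 A A D Q} (hC : C.TwoDet) (hC' : C.OneToOne)
    {γ : ℕ → Q × (Option A × Option A) × List D × Q} (hγ : C.IsAccRunOn γ x y) :
    1 ≤ liminf (fun n : ℕ =>
        (((c3out γ n).length : ℝ) * Real.log (Fintype.card D)) /
        (((c3in1 γ n).length : ℝ) * Real.log (Fintype.card A))) atTop := by
  have hA0 : 0 < Fintype.card A := by omega
  have : Nonempty A := Fintype.card_pos_iff.1 hA0
  have hlogA : 0 < Real.log (Fintype.card A) := Real.log_pos (by exact_mod_cast hA)
  have hlogD : 0 < Real.log (Fintype.card D) := Real.log_pos (by exact_mod_cast hD)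
  obtain ⟨K₀, hK₀⟩ := hγ.exists_le_mul hC fun ℓ hℓ u =>
    ⟨(Fintype.card A : ℝ)⁻¹ ^ ℓ, by positivity, h.symm.tendsto_blockOcc hA0 hℓ u⟩
  obtain ⟨L, hL⟩ := hC.exists_output_le
  have hpos : ∀ᶠ n in atTop, 1 ≤ (c3in1 γ n).length := tendsto_atTop.1 hγ.2.2.2.2.2.1 1
  have hbdd : IsCoboundedUnder (· ≥ ·) atTop fun n : ℕ =>
      (((c3out γ n).length : ℝ) * Real.log (Fintype.card D)) /
        (((c3in1 γ n).length : ℝ) * Real.log (Fintype.card A)) := by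
    refine IsBoundedUnder.isCoboundedUnder_ge
      ⟨L * K₀ * Real.log (Fintype.card D) / Real.log (Fintype.card A), ?_⟩
    rw [eventually_map]
    filter_upwards [hK₀, hpos] with n hn h1
    have h1' : (1 : ℝ) ≤ (c3in1 γ n).length := by exact_mod_cast h1
    have h2 : ((c3out γ n).length : ℝ) ≤ L * (K₀ * (c3in1 γ n).length) := by
      exact_mod_cast (c3out_length_le fun k _ => hL _ (hγ.2.1 k)).trans (Nat.mul_le_mul_left L hn)
    rw [div_le_div_iff₀ (by positivity) hlogA]
    have h3 := mul_le_mul_of_nonneg_right h2 (mul_pos hlogD hlogA).le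
    nlinarith
  have hK : ∀ K ≥ K₀, ((K : ℝ) / (K + 1)) ≤ liminf (fun n : ℕ =>
        (((c3out γ n).length : ℝ) * Real.log (Fintype.card D)) /
        (((c3in1 γ n).length : ℝ) * Real.log (Fintype.card A))) atTop := by
    intro K hKK
    refine le_liminf_of_le hbdd ?_
    filter_upwards [hpos, h.eventually_lt_output hA hC hC' hγ (K := K) (by
      filter_upwards [hK₀] with n hn
      exact hn.trans (Nat.mul_le_mul_right _ (by omega)))] with n h1 hn
    have h1' : (1 : ℝ) ≤ (c3in1 γ n).length := by exact_mod_cast h1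
    have h2 : (Fintype.card A : ℝ) ^ ((c3in1 γ n).length * K) <
        (Fintype.card D : ℝ) ^ ((c3out γ n).length * (K + 1)) := by exact_mod_cast hn
    have h3 := Real.log_lt_log (by positivity) h2
    rw [Real.log_pow, Real.log_pow] at h3
    push_cast at h3
    rw [div_le_div_iff₀ (by positivity) (by positivity)]
    nlinarith
  have hlim : Tendsto (fun K : ℕ => (K : ℝ) / (K + 1)) atTop (𝓝 1) :=
    tendsto_natCast_div_add_atTop (1 : ℝ)
  exact le_of_tendsto hlim (eventually_atTop.2 ⟨K₀, hK⟩)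

/-! ### Unconditional compressors as conditional compressors -/

/-- The conditional compressor that reads a symbol of the second input in every step and
otherwise behaves like `C`. -/
def Comp2.lift (B : Type*) (C : Comp2 A D Q) : Comp3 A B D Q where
  init := C.init
  trans := {t | (t.1, t.2.1.1, t.2.2) ∈ C.trans ∧ t.2.1.2.isSome = true}

theorem Comp2.OneDet.lift {C : Comp2 A D Q} (hC : C.OneDet) : (C.lift B).TwoDet := by
  rintro ⟨p, ⟨a, b⟩, w⟩ ⟨ht, hb⟩ ⟨p', ⟨a', b'⟩, w'⟩ ⟨ht', hb'⟩ rfl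
  obtain ⟨h1, h2⟩ := hC _ ht _ ht' rfl
  refine ⟨Prod.ext h1 (hb.trans hb'.symm), fun h => ?_⟩
  obtain ⟨rfl, rfl⟩ := Prod.mk.inj h
  have h3 := h2 rfl
  simp only [Prod.mk.injEq, true_and] at h3
  rw [h3]

theorem Comp2.isAccRunOn_of_lift {C : Comp2 A D Q}
    {γ : ℕ → Q × (Option A × Option B) × List D × Q} {x : ℕ → A} {y : ℕ → B}
    (h : (C.lift B).IsAccRunOn γ x y) :
    C.IsAccRunOn (fun n => ((γ n).1, (γ n).2.1.1, (γ n).2.2)) x :=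
  ⟨h.1, fun n => (h.2.1 n).1, h.2.2.1, h.2.2.2.1, h.2.2.2.2.2.1, h.2.2.2.2.2.2.2⟩

theorem Comp2.OneToOne.lift {C : Comp2 A D Q} (hC : C.OneToOne) : (C.lift B).OneToOne :=
  fun _ _ _ _ _ h h' ho ho' =>
    hC _ _ _ _ (Comp2.isAccRunOn_of_lift h) (Comp2.isAccRunOn_of_lift h') ho ho'

theorem optWord_some (y : ℕ → B) (n : ℕ) : optWord (fun i => some (y i)) n = pref y n := by
  induction n with
  | zero => rfl
  | succ n ih => rw [optWord_succ, ih, pref_succ, Option.toList_some]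

theorem Comp2.IsAccRunOn.lift {C : Comp2 A D Q} {γ : ℕ → Q × Option A × List D × Q} {x : ℕ → A}
    (h : C.IsAccRunOn γ x) (y : ℕ → B) :
    (C.lift B).IsAccRunOn (fun n => ((γ n).1, ((γ n).2.1, some (y n)), (γ n).2.2)) x y := by
  have hin : ∀ n, c3in2 (fun n => ((γ n).1, ((γ n).2.1, some (y n)), (γ n).2.2)) n = pref y n :=
    optWord_some y
  refine ⟨h.1, fun n => ⟨h.2.1 n, rfl⟩, h.2.2.1, h.2.2.2.1, fun n => ?_, h.2.2.2.2.1, ?_,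
    h.2.2.2.2.2⟩
  · rw [hin, pref_length]
  · simp only [hin, pref_length]
    exact tendsto_id

/-- The compressor that copies its input, up to the renaming `e` of symbols. -/
def copyComp (e : A → D) : Comp2 A D (Fin 1) where
  init := 0
  trans := {t | ∃ a, t = (0, some a, [e a], 0)}

theorem copyComp_oneDet (e : A → D) : (copyComp e).OneDet := by
  rintro _ ⟨a, rfl⟩ _ ⟨a', rfl⟩ _
  refine ⟨rfl, fun h => ?_⟩
  rw [Option.some.inj h]

theorem copyComp_run {e : A → D} {γ : ℕ → Fin 1 × Option A × List D × Fin 1} {x : ℕ → A}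
    (h : (copyComp e).IsAccRunOn γ x) (n : ℕ) : c2out γ n = (pref x n).map e := by
  choose z hz using h.2.1
  obtain rfl : γ = fun n => (0, some (z n), [e (z n)], 0) := funext hz
  have h1 : ∀ n, c2in (fun n => ((0 : Fin 1), some (z n), [e (z n)], (0 : Fin 1))) n = pref z n :=
    optWord_some z
  have h2 := h.2.2.2.1 n
  rw [h1, pref_length] at h2
  rw [← h2]
  simp only [c2out, pref, List.map_map]
  induction n with
  | zero => rfl
  | succ n ih =>
    have h3 := h.2.2.2.1 n
    rw [h1, pref_length] at h3
    simp [List.range_succ, ih h3]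

theorem copyComp_oneToOne {e : A → D} (he : Function.Injective e) :
    (copyComp e).OneToOne := by
  intro x x' γ γ' h h' ho _
  funext p
  obtain ⟨m, hm⟩ := ho (p + 1)
  rw [copyComp_run h, copyComp_run h'] at hm
  have hlen := hm.length_le
  simp only [List.length_map, pref_length] at hlen
  have h1 := List.prefix_iff_getElem?.1 hm p (by simp [pref_length])
  rw [List.getElem?_map, pref_getElem? x' (by omega), ← List.getElem?_eq_getElem,
    List.getElem?_map, pref_getElem? x (by omega)] at h1
  exact he (Option.some.inj h1.symm)

theorem exists_copyComp_isAccRunOn (e : A → D) (x : ℕ → A) :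
    ∃ γ, (copyComp e).IsAccRunOn γ x ∧ ∀ n, (c2in γ n).length = n ∧ (c2out γ n).length = n := by
  have hin : ∀ n, c2in (fun n => ((0 : Fin 1), some (x n), [e (x n)], (0 : Fin 1))) n = pref x n :=
    optWord_some x
  have hout : ∀ n, (c2out (fun n => ((0 : Fin 1), some (x n), [e (x n)], (0 : Fin 1))) n).length
      = n := fun n => by simp [c2out, Function.comp_def]
  refine ⟨_, ⟨rfl, fun n => ⟨x n, rfl⟩, fun n => rfl, fun n => ?_, ?_, ?_⟩, fun n => ⟨?_, hout n⟩⟩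
  · rw [hin, pref_length]
  · simp only [hin, pref_length]
    exact tendsto_id
  · simp only [hout]
    exact tendsto_id
  · rw [hin, pref_length]

theorem Passes.condRho_eq_one_and_rho_eq_one [Fintype A] [Primcodable A] (hA : 2 ≤ Fintype.card A) {x y : ℕ → A}
    (h : Passes x y) : condRho x y = 1 ∧ rho x = 1 := by
  have hlow : ∀ (m d : ℕ), 2 ≤ d → ∀ C : Comp3 A A (Fin d) (Fin m), C.TwoDet → C.OneToOne →
      ∀ γ, C.IsAccRunOn γ x y → 1 ≤ liminf (fun n : ℕ =>
        (((c3out γ n).length : ℝ) * Real.log d) /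
        (((c3in1 γ n).length : ℝ) * Real.log (Fintype.card A))) atTop := by
    intro m d hd C hC hC' γ hγ
    simpa only [Fintype.card_fin] using h.one_le_liminf hA (by rwa [Fintype.card_fin]) hC hC' hγ
  obtain ⟨γ₀, hrun, hlen⟩ := exists_copyComp_isAccRunOn (Fintype.equivFin A) x
  have hlogA : 0 < Real.log (Fintype.card A) := Real.log_pos (by exact_mod_cast hA)
  have hone : (1 : ℝ) = liminf (fun n : ℕ =>
      (((c2out γ₀ n).length : ℝ) * Real.log (Fintype.card A)) /
      (((c2in γ₀ n).length : ℝ) * Real.log (Fintype.card A))) atTop := by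
    rw [← liminf_const (f := (atTop : Filter ℕ)) (1 : ℝ)]
    refine liminf_congr ?_
    filter_upwards [eventually_gt_atTop 0] with n hn
    have hn' : (0 : ℝ) < n := by exact_mod_cast hn
    rw [(hlen n).1, (hlen n).2, div_self (by positivity)]
  have hdet := copyComp_oneDet (Fintype.equivFin A)
  have hinj := copyComp_oneToOne (Fintype.equivFin A).injective
  constructor
  · refine IsLeast.csInf_eq ⟨?_, ?_⟩
    · exact ⟨1, Fintype.card A, hA, (copyComp (Fintype.equivFin A)).lift A, hdet.lift, hinj.lift,
        _, hrun.lift y, hone⟩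
    · rintro _ ⟨m, d, hd, C, hC, hC', γ, hγ, rfl⟩
      exact hlow m d hd C hC hC' γ hγ
  · refine IsLeast.csInf_eq ⟨?_, ?_⟩
    · exact ⟨1, Fintype.card A, hA, copyComp (Fintype.equivFin A), hdet, hinj, γ₀, hrun, hone⟩
    · rintro _ ⟨m, d, hd, C, hC, hC', γ, hγ, rfl⟩
      have h1 := hlow m d hd (C.lift A) hC.lift hC'.lift _ (hγ.lift y)
      have hin : c3in1 (fun n => ((γ n).1, ((γ n).2.1, some (y n)), (γ n).2.2)) = c2in γ := rfl
      have hout : c3out (fun n => ((γ n).1, ((γ n).2.1, some (y n)), (γ n).2.2)) = c2out γ := rfl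
      rwa [hin, hout] at h1

theorem Passes.fsIndep [Fintype A] [Primcodable A] (hA : 2 ≤ Fintype.card A) {x y : ℕ → A}
    (h : Passes x y) : FSIndep x y := by
  obtain ⟨h1, h2⟩ := h.condRho_eq_one_and_rho_eq_one hA
  obtain ⟨h3, h4⟩ := h.symm.condRho_eq_one_and_rho_eq_one hA
  refine ⟨h1.trans h2.symm, h3.trans h4.symm, ?_, ?_⟩
  · rw [h2]
    exact one_pos
  · rw [h4]
    exact one_pos

/-- For every finite alphabet with at least two symbols there is a
pair of computable, normal, finite-state independent infinite words. -/
theorem exists_computable_normal_fsIndep_pair (A : Type*) [Fintype A]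
    (hA : 2 ≤ Fintype.card A) :
    ∃ x y : ℕ → A,
      (∃ e : A ≃ Fin (Fintype.card A), Computable fun n => e (x n)) ∧
      (∃ e : A ≃ Fin (Fintype.card A), Computable fun n => e (y n)) ∧
      Normal x ∧ Normal y ∧ FSIndep x y := by
  let _ : Primcodable A := Primcodable.ofEquiv (Fin (Fintype.card A)) (Fintype.equivFin A)
  have hA0 : 0 < Fintype.card A := by omega
  obtain ⟨x, y, hx, hy, h⟩ := exists_computable_passes hA0
  have he : Computable (Fintype.equivFin A) := (Primrec.dom_finite _).to_comp
  exact ⟨x, y, ⟨_, he.comp hx⟩, ⟨_, he.comp hy⟩, h.normal hA0, h.symm.normal hA0, h.fsIndep hA⟩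

end FSI
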